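/- arXiv:0810.2754 — 2 statements merged into one kernel-verified Lean document; each statement's English description precedes it below -/
import Mathlib

section
/- Let c₁, c₂, c₅, c₇ be real numbers with c₁ ≠ 0 and c₅c₇ > 0. Then the planar polynomial vector field given by u̇ = −c₅v + c₁uv + c₂v² − (c₅+c₇)u²v − (c₂(c₅+c₇)/c₁)uv², v̇ = −c₇u − (c₂(c₅+c₇)/c₁)v − c₁u² − c₂uv − (c₅+c₇)uv² − (c₂(c₅+c₇)/c₁)v³ has no limit cycles. -/
/-- `Γ` is a periodic orbit of the planar vector field `f`: the image of a nonconstant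
periodic solution. -/
def IsPeriodicOrbit2 (f : ℝ × ℝ → ℝ × ℝ) (Γ : Set (ℝ × ℝ)) : Prop :=
  ∃ (γ : ℝ → ℝ × ℝ) (T : ℝ),
    (∀ t, HasDerivAt γ (f (γ t)) t) ∧ 0 < T ∧ (∀ t, γ (t + T) = γ t) ∧
    (¬ ∀ t, γ t = γ 0) ∧ Γ = Set.range γ

/-- `Γ` is a limit cycle of the planar vector field `f`: a periodic orbit isolated in the set
of all periodic orbits of `f`. -/
def IsLimitCycle2 (f : ℝ × ℝ → ℝ × ℝ) (Γ : Set (ℝ × ℝ)) : Prop :=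
  IsPeriodicOrbit2 f Γ ∧ ∃ U : Set (ℝ × ℝ), IsOpen U ∧ Γ ⊆ U ∧
    ∀ Γ', IsPeriodicOrbit2 f Γ' → Γ' ⊆ U → Γ' = Γ

/-- The planar system obtained by central projection at `(0,0,-1)` of the family (eq. 144). -/
noncomputable def sys160 (c1 c2 c5 c7 : ℝ) : ℝ × ℝ → ℝ × ℝ := fun w =>
  (-c5 * w.2 + c1 * w.1 * w.2 + c2 * w.2 ^ 2 - (c5 + c7) * w.1 ^ 2 * w.2
      - (c2 * (c5 + c7) / c1) * w.1 * w.2 ^ 2,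
   -c7 * w.1 - (c2 * (c5 + c7) / c1) * w.2 - c1 * w.1 ^ 2 - c2 * w.1 * w.2
      - (c5 + c7) * w.1 * w.2 ^ 2 - (c2 * (c5 + c7) / c1) * w.2 ^ 3)

open Set Filter Topology Metric
open scoped NNReal

theorem hasDerivAt_fst_comp {γ : ℝ → ℝ × ℝ} {w : ℝ × ℝ} {t : ℝ} (h : HasDerivAt γ w t) :
    HasDerivAt (fun s ↦ (γ s).1) w.1 t :=
  (ContinuousLinearMap.fst ℝ ℝ ℝ).hasFDerivAt.comp_hasDerivAt t h

theorem hasDerivAt_snd_comp {γ : ℝ → ℝ × ℝ} {w : ℝ × ℝ} {t : ℝ} (h : HasDerivAt γ w t) :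
    HasDerivAt (fun s ↦ (γ s).2) w.2 t :=
  (ContinuousLinearMap.snd ℝ ℝ ℝ).hasFDerivAt.comp_hasDerivAt t h

theorem exists_global_solution_of_lipschitzWith {E : Type*} [NormedAddCommGroup E]
    [NormedSpace ℝ E] [CompleteSpace E] {g : E → E} {K C : ℝ≥0} (hg : LipschitzWith K g)
    (hC : ∀ x, ‖g x‖ ≤ C) (x : E) :
    ∃ γ : ℝ → E, γ 0 = x ∧ ∀ t, HasDerivAt γ (g (γ t)) t := by
  have key : ∀ a : ℝ, 0 < a → ∃ γ : ℝ → E, γ 0 = x ∧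
      ∀ t ∈ Ioo (-a) a, HasDerivAt γ (g (γ t)) t := by
    intro a ha
    have hpl : IsPicardLindelof (fun _ ↦ g) (tmin := -a) (tmax := a)
        ⟨0, by simp [ha.le]⟩ x (C * a.toNNReal) 0 C K :=
      .of_time_independent (fun y _ ↦ hC y) hg.lipschitzOnWith (by simp [ha.le])
    obtain ⟨γ, h0, hγ⟩ := hpl.exists_eq_forall_mem_Icc_hasDerivWithinAt₀
    exact ⟨γ, h0, fun t ht ↦ (hγ t (Ioo_subset_Icc_self ht)).hasDerivAt (Icc_mem_nhds ht.1 ht.2)⟩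
  choose! γ h0 hγ using key
  have hcompat : ∀ a b : ℝ, 0 < a → a ≤ b → EqOn (γ a) (γ b) (Ioo (-a) a) := by
    intro a b ha hab
    refine ODE_solution_unique_of_mem_Ioo (v := fun _ ↦ g) (s := fun _ ↦ univ) (t₀ := 0)
      (fun _ _ ↦ hg.lipschitzOnWith) ⟨by linarith, ha⟩ (fun t ht ↦ ⟨hγ a ha t ht, trivial⟩)
      (fun t ht ↦ ⟨hγ b (ha.trans_le hab) t ⟨by linarith [ht.1], by linarith [ht.2]⟩, trivial⟩) ?_
    rw [h0 a ha, h0 b (ha.trans_le hab)]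
  refine ⟨fun t ↦ γ (|t| + 1) t, h0 _ (by positivity), fun t ↦ ?_⟩
  have ht : t ∈ Ioo (-(|t| + 1)) (|t| + 1) := by
    rw [mem_Ioo, ← abs_lt]; exact lt_add_one _
  refine (hγ _ (by positivity) t ht).congr_of_eventuallyEq ?_
  filter_upwards [Ioo_mem_nhds ht.1 ht.2] with s hs
  have hs' : s ∈ Ioo (-(|s| + 1)) (|s| + 1) := by
    rw [mem_Ioo, ← abs_lt]; exact lt_add_one _
  rcases le_total (|s| + 1) (|t| + 1) with h | h
  · exact hcompat _ _ (by positivity) h hs'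
  · exact (hcompat _ _ (by positivity) h hs).symm

theorem eq_of_lipschitzWith_of_hasDerivAt {E : Type*} [NormedAddCommGroup E]
    [NormedSpace ℝ E] {g : E → E} {K : ℝ≥0} (hg : LipschitzWith K g) {α β : ℝ → E}
    (hα : ∀ t, HasDerivAt α (g (α t)) t) (hβ : ∀ t, HasDerivAt β (g (β t)) t) {t₀ : ℝ}
    (h : α t₀ = β t₀) : α = β :=
  ODE_solution_unique_univ (v := fun _ ↦ g) (s := fun _ ↦ univ)
    (fun _ ↦ hg.lipschitzOnWith) (fun t ↦ ⟨hα t, trivial⟩) (fun t ↦ ⟨hβ t, trivial⟩) h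

/-- The vector field `f` is reversible with respect to the reflection `(u, v) ↦ (u, -v)`. -/
def IsReversible (f : ℝ × ℝ → ℝ × ℝ) : Prop :=
  ∀ w : ℝ × ℝ, f (w.1, -w.2) = (-(f w).1, (f w).2)

theorem IsReversible.hasDerivAt_reflect {f : ℝ × ℝ → ℝ × ℝ} (hf : IsReversible f)
    {γ : ℝ → ℝ × ℝ} (hγ : ∀ t, HasDerivAt γ (f (γ t)) t) (c t : ℝ) :
    HasDerivAt (fun s ↦ ((γ (c - s)).1, -(γ (c - s)).2))
      (f ((γ (c - t)).1, -(γ (c - t)).2)) t := by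
  have h : HasDerivAt (fun s ↦ γ (c - s)) (-(f (γ (c - t)))) t :=
    HasDerivAt.comp_const_sub c t (hγ (c - t))
  rw [hf]
  simpa using (hasDerivAt_fst_comp h).prodMk (hasDerivAt_snd_comp h).neg

theorem IsReversible.apply_sub_eq_reflect {g : ℝ × ℝ → ℝ × ℝ} (hg : IsReversible g) {K : ℝ≥0}
    (hK : LipschitzWith K g) {γ : ℝ → ℝ × ℝ} (hγ : ∀ t, HasDerivAt γ (g (γ t)) t) {a : ℝ}
    (ha : (γ a).2 = 0) (t : ℝ) : γ (2 * a - t) = ((γ t).1, -(γ t).2) := by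
  have h := eq_of_lipschitzWith_of_hasDerivAt hK hγ (hg.hasDerivAt_reflect hγ (2 * a)) (t₀ := a)
    (by ext <;> simp [two_mul, ha])
  simpa using congrFun h (2 * a - t)

theorem exists_lipschitzWith_eqOn_closedBall {f : ℝ × ℝ → ℝ × ℝ} (hf : ContDiff ℝ 1 f)
    (hrev : IsReversible f) {M : ℝ} (hM : 0 ≤ M) :
    ∃ (g : ℝ × ℝ → ℝ × ℝ) (K C : ℝ≥0), LipschitzWith K g ∧ (∀ x, ‖g x‖ ≤ C) ∧ IsReversible g ∧
      ∀ x, ‖x‖ ≤ M → g x = f x := by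
  set c : ℝ → ℝ := fun x ↦ max (-M) (min M x) with hc
  have hc1 : LipschitzWith 1 c := (LipschitzWith.id.const_min M).const_max (-M)
  have hcmem : ∀ x, |c x| ≤ M := fun x ↦ by
    rw [abs_le]; exact ⟨le_max_left _ _, max_le (by linarith) (min_le_left _ _)⟩
  have hcneg : ∀ x, c (-x) = -c x := fun x ↦ by
    simp only [hc]
    grind
  have hcid : ∀ x, |x| ≤ M → c x = x := fun x hx ↦ by
    rw [abs_le] at hx
    simp [hc, hx.1, hx.2]
  set p : ℝ × ℝ → ℝ × ℝ := fun w ↦ (c w.1, c w.2) with hp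
  have hp1 : LipschitzWith 1 p := by
    have := (hc1.comp LipschitzWith.prod_fst).prodMk (hc1.comp LipschitzWith.prod_snd)
    simpa using this
  have hpmem : ∀ w, p w ∈ closedBall (0 : ℝ × ℝ) M := fun w ↦ by
    rw [mem_closedBall_zero_iff, Prod.norm_def]
    exact max_le (hcmem _) (hcmem _)
  obtain ⟨K, hK⟩ := hf.contDiffOn.exists_lipschitzOnWith (s := closedBall (0 : ℝ × ℝ) M)
    one_ne_zero (convex_closedBall _ _) (isCompact_closedBall _ _)
  obtain ⟨C, hC⟩ := (isCompact_closedBall (0 : ℝ × ℝ) M).exists_bound_of_continuousOn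
    hf.continuous.continuousOn
  refine ⟨f ∘ p, K, C.toNNReal, ?_, fun x ↦ (hC _ (hpmem x)).trans (Real.le_coe_toNNReal C),
    fun w ↦ ?_, fun x hx ↦ ?_⟩
  · have := hK.comp (hp1.lipschitzOnWith (s := univ)) (fun w _ ↦ hpmem w)
    rwa [mul_one, lipschitzOnWith_univ] at this
  · simp only [Function.comp_apply, hp, hcneg]
    exact hrev (c w.1, c w.2)
  · rw [Prod.norm_def, max_le_iff] at hx
    simp [hp, hcid _ hx.1, hcid _ hx.2]

theorem countable_setOf_eq_zero_of_hasDerivAt_ne_zero {f f' : ℝ → ℝ}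
    (hf : ∀ t, HasDerivAt f (f' t) t) (h : ∀ t, f t = 0 → f' t ≠ 0) :
    {t | f t = 0}.Countable := by
  refine IsLindelof.countable_of_isDiscrete (HereditarilyLindelofSpace.isLindelof _) ?_
  rw [isDiscrete_iff_nhdsNE]
  intro t ht
  have := (hf t).eventually_ne (c := 0) (h t ht)
  rw [← disjoint_iff]
  exact (disjoint_principal_right.2 this)

theorem eq_zero_of_hasDerivAt_eq_mul_add_of_periodic {f a b : ℝ → ℝ} {T t₀ : ℝ} (hT : 0 < T)
    (ha : Continuous a) (hf : ∀ t, HasDerivAt f (a t * f t + b t) t) (hb : ∀ t, 0 ≤ b t)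
    (hper : f.Periodic T) (h0 : f t₀ = 0) (t : ℝ) : f t = 0 := by
  set A : ℝ → ℝ := fun t ↦ ∫ s in (0 : ℝ)..t, a s with hA
  have hAd : ∀ t, HasDerivAt A (a t) t := fun t ↦ ha.integral_hasStrictDerivAt 0 t |>.hasDerivAt
  have hF : ∀ t, HasDerivAt (fun s ↦ f s * Real.exp (-A s)) (b t * Real.exp (-A t)) t := fun t ↦ by
    refine ((hf t).mul (hAd t).neg.exp).congr_deriv ?_
    rw [Pi.neg_apply]
    ring
  have hmono : Monotone (fun s ↦ f s * Real.exp (-A s)) :=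
    monotone_of_deriv_nonneg (fun t ↦ (hF t).differentiableAt) fun t ↦ by
      rw [(hF t).deriv]; exact mul_nonneg (hb t) (Real.exp_pos _).le
  have hz : ∀ n : ℤ, f (t₀ + n * T) = 0 := fun n ↦ by
    rw [hper.int_mul n t₀, h0]
  obtain ⟨n, hn⟩ := exists_int_gt ((t - t₀) / T)
  obtain ⟨m, hm⟩ := exists_int_lt ((t - t₀) / T)
  rw [div_lt_iff₀ hT] at hn
  rw [lt_div_iff₀ hT] at hm
  have h1 := hmono (show t ≤ t₀ + n * T by linarith)
  have h2 := hmono (show t₀ + m * T ≤ t by linarith)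
  simp only [hz, zero_mul] at h1 h2
  have := le_antisymm h1 h2
  simpa [Real.exp_ne_zero] using this

theorem eq_zero_of_hasDerivAt_nonneg_of_periodic {f b : ℝ → ℝ} {T : ℝ} (hT : 0 < T)
    (hf : ∀ t, HasDerivAt f (b t) t) (hb : ∀ t, 0 ≤ b t) (hper : f.Periodic T) (t : ℝ) :
    b t = 0 := by
  have hconst : ∀ s, f s - f t = 0 :=
    eq_zero_of_hasDerivAt_eq_mul_add_of_periodic (a := 0) (t₀ := t) hT continuous_const
      (fun s ↦ by simpa using (hf s).sub_const (f t)) hb (fun s ↦ by simp [hper s]) (sub_self _)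
  have : f = fun _ ↦ f t := funext fun s ↦ sub_eq_zero.1 (hconst s)
  have h := hf t
  rw [this] at h
  exact h.unique (hasDerivAt_const t _)

theorem IsReversible.exists_isPeriodicOrbit2_subset {f : ℝ × ℝ → ℝ × ℝ} (hf : ContDiff ℝ 1 f)
    (hrev : IsReversible f) {γ : ℝ → ℝ × ℝ} {T : ℝ} (hγ : ∀ t, HasDerivAt γ (f (γ t)) t)
    (hT : 0 < T) (hper : γ.Periodic T) (hne : ¬ ∀ t, γ t = γ 0) (h0 : (γ 0).2 = 0)
    {U : Set (ℝ × ℝ)} (hU : IsOpen U) (hγU : range γ ⊆ U) :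
    ∃ Γ, IsPeriodicOrbit2 f Γ ∧ Γ ⊆ U ∧ Γ ≠ range γ := by
  have hγc : Continuous γ := continuous_iff_continuousAt.2 fun t ↦ (hγ t).continuousAt
  have hcomp : IsCompact (range γ) := hper.compact_of_continuous hT.ne' hγc
  obtain ⟨ε, hε, hεU⟩ := hcomp.exists_thickening_subset_open hU hγU
  obtain ⟨M, hM0, hM⟩ := hcomp.isBounded.exists_pos_norm_le
  obtain ⟨g, K, C, hgK, hgC, hgrev, hgf⟩ :=
    exists_lipschitzWith_eqOn_closedBall hf hrev (M := M + ε) (by positivity)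
  have hgγ : ∀ t, g (γ t) = f (γ t) := fun t ↦
    hgf _ ((hM _ (mem_range_self t)).trans (by linarith))
  have hγg : ∀ t, HasDerivAt γ (g (γ t)) t := fun t ↦ (hgγ t).symm ▸ hγ t
  have hzero : ∀ t, (γ t).2 = 0 → (f (γ t)).2 ≠ 0 := by
    intro t ht h
    have h1 : (f (γ t)).1 = 0 := by
      have := congrArg Prod.fst (hrev (γ t))
      rw [show ((γ t).1, -(γ t).2) = γ t by ext <;> simp [ht]] at this
      simp only at this
      linarith
    have hc : γ = fun _ ↦ γ t := eq_of_lipschitzWith_of_hasDerivAt hgK hγg (t₀ := t)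
      (fun s ↦ by rw [hgγ t, show f (γ t) = 0 from Prod.ext h1 h]; exact hasDerivAt_const s _) rfl
    exact hne fun s ↦ (congrFun hc s).trans (congrFun hc 0).symm
  have hγsymm : ∀ t, γ (-t) = ((γ t).1, -(γ t).2) := fun t ↦ by
    simpa using hgrev.apply_sub_eq_reflect hgK hγg h0 t
  -- `v` changes sign at time `T`
  set s := (f (γ 0)).2 with hs
  have hs0 : s ≠ 0 := hzero 0 h0
  have hT0 : γ T = γ 0 := by simpa using hper 0
  obtain ⟨δ, hδ0, hδ1, hδT, hδneg, hδpos⟩ : ∃ δ > 0, δ < 1 ∧ δ < T ∧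
      (γ (T - δ)).2 * s < 0 ∧ 0 < (γ (T + δ)).2 * s := by
    have hd : HasDerivAt (fun t ↦ (γ t).2 * s) (s * s) T := by
      have := (hasDerivAt_snd_comp (hγ T)).mul_const s
      rwa [hT0] at this
    have hpos : 0 < s * s := mul_self_pos.2 hs0
    have hev := (hasDerivAt_iff_tendsto_slope.1 hd).eventually (lt_mem_nhds hpos)
    rw [eventually_nhdsWithin_iff, Metric.eventually_nhds_iff] at hev
    obtain ⟨r, hr, hev⟩ := hev
    obtain ⟨δ, hδ0, hδ⟩ := exists_between (lt_min hr (lt_min one_pos hT))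
    simp only [lt_min_iff] at hδ
    refine ⟨δ, hδ0, hδ.2.1, hδ.2.2, ?_, ?_⟩
    · have := hev (y := T - δ) (by rw [Real.dist_eq, abs_lt]; constructor <;> linarith)
        (by simp [hδ0.ne'])
      rw [slope_def_field, hT0, h0, zero_mul, sub_zero] at this
      rcases div_pos_iff.1 this with h | h
      · linarith [h.2]
      · exact h.1
    · have := hev (y := T + δ) (by rw [Real.dist_eq, abs_lt]; constructor <;> linarith)
        (by simp [hδ0.ne'])
      rw [slope_def_field, hT0, h0, zero_mul, sub_zero] at this
      rcases div_pos_iff.1 this with h | h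
      · exact h.1
      · linarith [h.2]
  have hcount : {x : ℝ | (x, (0 : ℝ)) ∈ range γ}.Countable := by
    refine ((countable_setOf_eq_zero_of_hasDerivAt_ne_zero
      (fun t ↦ hasDerivAt_snd_comp (hγ t)) hzero).image fun t ↦ (γ t).1).mono ?_
    rintro x ⟨t, ht⟩
    exact ⟨t, by simp [ht], by simp [ht]⟩
  -- a nearby initial point on the symmetry axis
  obtain ⟨η, hη0, hηε, hη1, hη2⟩ : ∃ η > 0, η ≤ ε ∧ η ≤ |(γ (T - δ)).2| ∧
      η ≤ |(γ (T + δ)).2| :=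
    ⟨min ε (min |(γ (T - δ)).2| |(γ (T + δ)).2|),
      lt_min hε (lt_min (abs_pos.2 fun h ↦ by simp [h] at hδneg)
        (abs_pos.2 fun h ↦ by simp [h] at hδpos)),
      min_le_left _ _, (min_le_right _ _).trans (min_le_left _ _),
      (min_le_right _ _).trans (min_le_right _ _)⟩
  set E := Real.exp (K * (T + 1)) with hE
  have hE0 : 0 < E := Real.exp_pos _
  obtain ⟨x, hxc, hxd⟩ := (hcount.dense_compl ℝ).exists_dist_lt (γ 0).1
    (show 0 < η / E by positivity)
  obtain ⟨β, hβ0, hβ⟩ := exists_global_solution_of_lipschitzWith hgK hgC (x, 0)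
  have hβc : Continuous β := continuous_iff_continuousAt.2 fun t ↦ (hβ t).continuousAt
  have hclose : ∀ t ∈ Icc 0 (T + 1), dist (β t) (γ t) < η := by
    intro t ht
    refine (dist_le_of_trajectories_ODE (v := fun _ ↦ g) (δ := dist (β 0) (γ 0)) (fun _ ↦ hgK)
      hβc.continuousOn (fun t _ ↦ (hβ t).hasDerivWithinAt) hγc.continuousOn
      (fun t _ ↦ (hγg t).hasDerivWithinAt) le_rfl t ht).trans_lt ?_
    have hd : dist (β 0) (γ 0) < η / E := by
      rw [hβ0, Prod.dist_eq, h0, dist_self, max_eq_left dist_nonneg, dist_comm]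
      exact hxd
    calc dist (β 0) (γ 0) * Real.exp (K * (t - 0)) ≤ dist (β 0) (γ 0) * E := by
          rw [hE]; gcongr; linarith [ht.2]
      _ < η / E * E := by gcongr
      _ = η := by field_simp
  have hclose2 : ∀ t ∈ Icc 0 (T + 1), |(β t).2 - (γ t).2| < η := fun t ht ↦
    (le_max_right _ _).trans_lt (hclose t ht)
  have hsign : ∀ {a b : ℝ}, |a - b| < η → η ≤ |b| → 0 < a * b := by
    intro a b h1 h2
    have := h1.trans_le h2
    rw [abs_lt] at this
    rcases abs_cases b with ⟨hb, hb'⟩ | ⟨hb, hb'⟩ <;> rw [hb] at this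
    · exact mul_pos (by linarith [this.1]) (by linarith)
    · exact mul_pos_of_neg_of_neg (by linarith [this.2]) (by linarith)
  have hβneg : (β (T - δ)).2 * s < 0 := by
    have := hsign (hclose2 (T - δ) ⟨by linarith, by linarith⟩) hη1
    by_contra! h
    nlinarith [mul_pos this (mul_self_pos.2 hs0), mul_nonneg h (neg_nonneg.2 hδneg.le)]
  have hβpos : 0 < (β (T + δ)).2 * s := by
    have := hsign (hclose2 (T + δ) ⟨by linarith, by linarith⟩) hη2
    by_contra! h
    nlinarith [mul_pos this (mul_self_pos.2 hs0), mul_nonneg (neg_nonneg.2 h) hδpos.le]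
  obtain ⟨p, hp, hpz⟩ : ∃ p ∈ Icc (T - δ) (T + δ), (β p).2 * s = 0 :=
    intermediate_value_Icc (by linarith) (by fun_prop : Continuous fun t ↦ (β t).2 * s).continuousOn
      ⟨hβneg.le, hβpos.le⟩
  replace hpz : (β p).2 = 0 := (mul_eq_zero.1 hpz).resolve_right hs0
  have hp0 : 0 < p := by linarith [hp.1]
  have hβsymm : ∀ t, β (-t) = ((β t).1, -(β t).2) := fun t ↦ by
    simpa using hgrev.apply_sub_eq_reflect hgK hβ (a := 0) (by simp [hβ0]) t
  have hβper : β.Periodic (2 * p) := by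
    intro t
    have := hgrev.apply_sub_eq_reflect hgK hβ hpz (-t)
    rw [hβsymm t] at this
    rw [show t + 2 * p = 2 * p - -t by ring, this]
    simp
  have hnear : ∀ t, ∃ t', dist (β t) (γ t') < η := by
    intro t
    obtain ⟨t', ht', h⟩ := hβper.exists_mem_Ico (by linarith) t (-p)
    rw [h]
    rcases le_total 0 t' with h0 | h0
    · exact ⟨t', hclose t' ⟨h0, by linarith [ht'.2, hp.2]⟩⟩
    · refine ⟨t', ?_⟩
      have := hclose (-t') ⟨by linarith, by linarith [ht'.1, hp.2]⟩
      rw [hβsymm, hγsymm, Prod.dist_eq] at this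
      rw [Prod.dist_eq]
      simpa using this
  have hgβ : ∀ t, g (β t) = f (β t) := by
    intro t
    obtain ⟨t', ht'⟩ := hnear t
    apply hgf
    have h1 := hM _ (mem_range_self t')
    have h2 : ‖β t‖ ≤ ‖γ t'‖ + ‖β t - γ t'‖ := norm_le_norm_add_norm_sub' _ _
    rw [← dist_eq_norm] at h2
    linarith
  refine ⟨range β, ⟨β, 2 * p, fun t ↦ hgβ t ▸ hβ t, by linarith, hβper, fun h ↦ ?_, rfl⟩, ?_, ?_⟩
  · rw [h, hβ0] at hβpos
    simp at hβpos
  · rintro _ ⟨t, rfl⟩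
    obtain ⟨t', ht'⟩ := hnear t
    exact hεU (mem_thickening_iff.2 ⟨_, mem_range_self t', ht'.trans_le hηε⟩)
  · intro h
    apply hxc
    change (x, (0 : ℝ)) ∈ range γ
    rw [← h, ← hβ0]
    exact mem_range_self 0

theorem exists_hasDerivAt_of_continuousOn_Icc {φ : ℝ → ℝ} {a b : ℝ} (hab : a ≤ b)
    (hφ : ContinuousOn φ (Icc a b)) :
    ∃ F : ℝ → ℝ, ∀ x ∈ Icc a b, HasDerivAt F (φ x) x := by
  refine ⟨fun x ↦ ∫ s in a..x, IccExtend hab ((Icc a b).domRestrict φ) s, fun x hx ↦ ?_⟩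
  have := (hφ.domRestrict.Icc_extend' (h := hab)).integral_hasStrictDerivAt a x |>.hasDerivAt
  rwa [IccExtend_of_mem _ _ hx] at this

section

variable {c1 c2 c5 c7 m : ℝ} {γ : ℝ → ℝ × ℝ} {T : ℝ}

theorem sys160_eq (hc1 : c1 ≠ 0) (hm : c5 + c7 = m * c1) (u v : ℝ) :
    sys160 c1 c2 c5 c7 (u, v) =
      (v * (-c5 + c1 * u - m * c1 * u ^ 2) + c2 * (1 - m * u) * v ^ 2,
        -u * (c7 + c1 * u + m * c1 * v ^ 2) - c2 * v * (u + m + m * v ^ 2)) := by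
  simp only [sys160, hm]
  ext <;> simp only <;> field_simp <;> ring

theorem contDiff_sys160 : ContDiff ℝ 1 (sys160 c1 c2 c5 c7) := by
  unfold sys160
  fun_prop

theorem isReversible_sys160 : IsReversible (sys160 c1 0 c5 c7) := by
  rintro ⟨u, v⟩
  simp only [sys160]
  ext <;> simp only <;> ring

theorem eq_apply_zero_of_sys160_eq_zero (hγ : ∀ t, HasDerivAt γ (sys160 c1 c2 c5 c7 (γ t)) t)
    (hT : 0 < T) (hper : γ.Periodic T) {t₀ : ℝ} (h : sys160 c1 c2 c5 c7 (γ t₀) = 0) (t : ℝ) :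
    γ t = γ 0 := by
  have hγc : Continuous γ := continuous_iff_continuousAt.2 fun t ↦ (hγ t).continuousAt
  obtain ⟨M, -, hM⟩ :=
    (hper.compact_of_continuous hT.ne' hγc).isBounded.exists_pos_norm_le
  obtain ⟨K, hK⟩ := contDiff_sys160.contDiffOn.exists_lipschitzOnWith
    (f := sys160 c1 c2 c5 c7) (s := closedBall (0 : ℝ × ℝ) M)
    one_ne_zero (convex_closedBall _ _) (isCompact_closedBall _ _)
  have hmem : ∀ t, γ t ∈ closedBall (0 : ℝ × ℝ) M := fun t ↦
    mem_closedBall_zero_iff.2 (hM _ (mem_range_self t))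
  have hc : γ = fun _ ↦ γ t₀ := ODE_solution_unique_univ (v := fun _ ↦ sys160 c1 c2 c5 c7)
    (s := fun _ ↦ closedBall 0 M) (fun _ ↦ hK) (fun t ↦ ⟨hγ t, hmem t⟩)
    (fun t ↦ ⟨h ▸ hasDerivAt_const t _, hmem t₀⟩) (t₀ := t₀) rfl
  exact (congrFun hc t).trans (congrFun hc 0).symm

theorem hasDerivAt_fst_sys160 (hc1 : c1 ≠ 0) (hm : c5 + c7 = m * c1)
    (hγ : ∀ t, HasDerivAt γ (sys160 c1 c2 c5 c7 (γ t)) t) (t : ℝ) :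
    HasDerivAt (fun s ↦ (γ s).1) ((γ t).2 * (-c5 + c1 * (γ t).1 - m * c1 * (γ t).1 ^ 2) +
      c2 * (1 - m * (γ t).1) * (γ t).2 ^ 2) t := by
  have := hasDerivAt_fst_comp (hγ t)
  rwa [show γ t = ((γ t).1, (γ t).2) from rfl, sys160_eq hc1 hm] at this

theorem hasDerivAt_snd_sys160 (hc1 : c1 ≠ 0) (hm : c5 + c7 = m * c1)
    (hγ : ∀ t, HasDerivAt γ (sys160 c1 c2 c5 c7 (γ t)) t) (t : ℝ) :
    HasDerivAt (fun s ↦ (γ s).2) (-(γ t).1 * (c7 + c1 * (γ t).1 + m * c1 * (γ t).2 ^ 2) -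
      c2 * (γ t).2 * ((γ t).1 + m + m * (γ t).2 ^ 2)) t := by
  have := hasDerivAt_snd_comp (hγ t)
  rwa [show γ t = ((γ t).1, (γ t).2) from rfl, sys160_eq hc1 hm] at this

theorem fst_eq_of_quadratic_eq_zero (hc1 : c1 ≠ 0) (hm : c5 + c7 = m * c1)
    (hγ : ∀ t, HasDerivAt γ (sys160 c1 c2 c5 c7 (γ t)) t) (hT : 0 < T) (hper : γ.Periodic T)
    {t₀ : ℝ} (h0 : -c5 + c1 * (γ t₀).1 - m * c1 * (γ t₀).1 ^ 2 = 0) (t : ℝ) :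
    (γ t).1 = (γ t₀).1 := by
  have hγc : Continuous γ := continuous_iff_continuousAt.2 fun t ↦ (hγ t).continuousAt
  set r := (γ t₀).1 with hr
  set a : ℝ → ℝ := fun t ↦ (γ t).2 * (c1 - m * c1 * ((γ t).1 + r)) - c2 * m * (γ t).2 ^ 2
  have ha : Continuous a := by fun_prop
  have hd : ∀ t, HasDerivAt (fun s ↦ (γ s).1 - r)
      (a t * ((γ t).1 - r) + c2 * (1 - m * r) * (γ t).2 ^ 2) t := fun t ↦ by
    refine ((hasDerivAt_fst_sys160 hc1 hm hγ t).sub_const r).congr_deriv ?_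
    simp only [a]
    linear_combination (γ t).2 * h0
  rcases le_total 0 (c2 * (1 - m * r)) with hs | hs
  · exact sub_eq_zero.1 <| eq_zero_of_hasDerivAt_eq_mul_add_of_periodic hT ha hd
      (fun t ↦ by positivity) (fun t ↦ by simp [hper t]) (t₀ := t₀) (by simp [hr]) t
  · have hd' : ∀ t, HasDerivAt (fun s ↦ r - (γ s).1)
        (a t * (r - (γ t).1) + -(c2 * (1 - m * r)) * (γ t).2 ^ 2) t := fun t ↦ by
      refine ((hasDerivAt_fst_sys160 hc1 hm hγ t).const_sub r).congr_deriv ?_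
      simp only [a]
      linear_combination -(γ t).2 * h0
    exact (sub_eq_zero.1 <| eq_zero_of_hasDerivAt_eq_mul_add_of_periodic hT ha hd'
      (fun t ↦ mul_nonneg (by linarith) (sq_nonneg _)) (fun t ↦ by simp [hper t]) (t₀ := t₀)
      (by simp [hr]) t).symm

theorem eq_apply_zero_of_quadratic_eq_zero (hc1 : c1 ≠ 0) (hm : c5 + c7 = m * c1)
    (hγ : ∀ t, HasDerivAt γ (sys160 c1 c2 c5 c7 (γ t)) t) (hT : 0 < T) (hper : γ.Periodic T)
    {t₀ : ℝ} (h0 : -c5 + c1 * (γ t₀).1 - m * c1 * (γ t₀).1 ^ 2 = 0) (t : ℝ) : γ t = γ 0 := by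
  have hγc : Continuous γ := continuous_iff_continuousAt.2 fun t ↦ (hγ t).continuousAt
  have hu := fst_eq_of_quadratic_eq_zero hc1 hm hγ hT hper h0
  have hu' : ∀ t, (sys160 c1 c2 c5 c7 (γ t)).1 = 0 := fun t ↦ by
    have h1 := hasDerivAt_fst_comp (hγ t)
    rw [funext hu] at h1
    exact h1.unique (hasDerivAt_const t _)
  obtain ⟨t₁, -, ht₁⟩ := exists_hasDerivAt_eq_zero (f := fun s ↦ (γ s).2) (a := 0) (b := T) hT
    (by fun_prop) (by simpa using congrArg Prod.snd (hper 0).symm)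
    fun t _ ↦ hasDerivAt_snd_comp (hγ t)
  exact eq_apply_zero_of_sys160_eq_zero hγ hT hper (Prod.ext (hu' t₁) ht₁) t

theorem not_isLimitCycle2_sys160_of_eq_zero (hc1 : c1 ≠ 0) (hm : c5 + c7 = m * c1)
    (Γ : Set (ℝ × ℝ)) : ¬ IsLimitCycle2 (sys160 c1 0 c5 c7) Γ := by
  rintro ⟨⟨γ, T, hγ, hT, hper, hne, rfl⟩, U, hU, hγU, hiso⟩
  have hγc : Continuous γ := continuous_iff_continuousAt.2 fun t ↦ (hγ t).continuousAt
  obtain ⟨t₀, -, ht₀⟩ := exists_hasDerivAt_eq_zero (f := fun s ↦ (γ s).1) (a := 0) (b := T) hT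
    (by fun_prop) (by simpa using congrArg Prod.fst (hper 0).symm)
    fun t _ ↦ hasDerivAt_fst_sys160 hc1 hm hγ t
  have hv : (γ t₀).2 = 0 := by
    rw [zero_mul, zero_mul, add_zero] at ht₀
    exact (mul_eq_zero.1 ht₀).resolve_right fun h ↦
      hne (eq_apply_zero_of_quadratic_eq_zero hc1 hm hγ hT hper h)
  have hrange : range (fun t ↦ γ (t + t₀)) = range γ :=
    (Equiv.addRight t₀).surjective.range_comp γ
  obtain ⟨Γ, hΓ, hΓU, hΓne⟩ := isReversible_sys160.exists_isPeriodicOrbit2_subset contDiff_sys160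
    (γ := fun t ↦ γ (t + t₀)) (T := T) (fun t ↦ (hγ (t + t₀)).comp_add_const t t₀) hT
    (fun t ↦ by simp only [add_right_comm t T t₀, hper (t + t₀)])
    (fun h ↦ hne fun t ↦ by
      have h1 := h (t - t₀)
      have h2 := h (-t₀)
      simp only [sub_add_cancel, neg_add_cancel] at h1 h2
      rw [h1, h2])
    (by simpa using hv) hU (hrange ▸ hγU)
  exact hΓne ((hiso Γ hΓ hΓU).trans hrange.symm)

theorem not_isPeriodicOrbit2_sys160 (hc1 : c1 ≠ 0) (hm : c5 + c7 = m * c1) (hm0 : m ≠ 0)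
    (hc5 : c5 ≠ 0) (hc2 : c2 ≠ 0) (Γ : Set (ℝ × ℝ)) :
    ¬ IsPeriodicOrbit2 (sys160 c1 c2 c5 c7) Γ := by
  rintro ⟨γ, T, hγ, hT, hper, hne, rfl⟩
  have hγc : Continuous γ := continuous_iff_continuousAt.2 fun t ↦ (hγ t).continuousAt
  set q : ℝ → ℝ := fun u ↦ -c5 + c1 * u - m * c1 * u ^ 2 with hq
  have hq0 : ∀ t, q (γ t).1 ≠ 0 := fun t h ↦
    hne (eq_apply_zero_of_quadratic_eq_zero hc1 hm hγ hT hper h)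
  obtain ⟨a, b, hab, hrange⟩ : ∃ a b, a ≤ b ∧ range (fun t ↦ (γ t).1) = Icc a b := by
    have hfc : Continuous fun t ↦ (γ t).1 := by fun_prop
    have hfp : Function.Periodic (fun t ↦ (γ t).1) T := fun t ↦ by simp [hper t]
    have h := eq_Icc_of_connected_compact (isConnected_range hfc)
      (hfp.compact_of_continuous hT.ne' hfc)
    exact ⟨_, _, nonempty_Icc.1 (h ▸ range_nonempty _), h⟩
  have hmem : ∀ t, (γ t).1 ∈ Icc a b := fun t ↦ hrange ▸ mem_range_self t
  have hqI : ∀ x ∈ Icc a b, q x ≠ 0 := fun x hx ↦ by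
    rw [← hrange] at hx
    obtain ⟨t, rfl⟩ := hx
    exact hq0 t
  obtain ⟨L, hL⟩ := exists_hasDerivAt_of_continuousOn_Icc hab (φ := fun x ↦ (4 * (m * c1) * x - c1) / q x)
    (by
      refine ContinuousOn.div (by fun_prop) (by simp only [hq]; fun_prop) hqI)
  obtain ⟨P, hP⟩ := exists_hasDerivAt_of_continuousOn_Icc hab
    (φ := fun x ↦ Real.exp (L x) * (x * (c7 + c1 * x)))
    (by
      have : ContinuousOn L (Icc a b) := fun x hx ↦ (hL x hx).continuousAt.continuousWithinAt
      fun_prop)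
  set H : ℝ → ℝ := fun t ↦ Real.exp (L (γ t).1) * q (γ t).1 * ((γ t).2 ^ 2 / 2) + P (γ t).1 with hH
  set D : ℝ → ℝ := fun t ↦
    Real.exp (L (γ t).1) * (γ t).2 ^ 2 * (1 + (γ t).1 ^ 2 + (γ t).2 ^ 2) with hD
  have hHd : ∀ t, HasDerivAt H (c2 * c5 * m * D t) t := fun t ↦ by
    have hu := hasDerivAt_fst_sys160 hc1 hm hγ t
    have hv := hasDerivAt_snd_sys160 hc1 hm hγ t
    have hLd := ((hL _ (hmem t)).comp t hu).exp
    have hPd := (hP _ (hmem t)).comp t hu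
    have hqd := ((hu.const_mul c1).const_add (-c5)).sub ((hu.pow 2).const_mul (m * c1))
    refine (((hLd.mul hqd).mul ((hv.pow 2).div_const 2)).add hPd).congr_deriv ?_
    have h0 := hq0 t
    simp only [hD, Pi.mul_apply, Pi.sub_apply, Pi.pow_apply, Function.comp_apply]
    generalize (γ t).1 = u at *
    generalize (γ t).2 = v at *
    have hc7 : c7 = m * c1 - c5 := by linarith
    simp only [hq] at h0 ⊢
    field_simp
    subst hc7
    ring
  have hHper : H.Periodic T := fun t ↦ by simp only [hH, hper t]
  have hDnn : ∀ t, 0 ≤ D t := fun t ↦ by positivity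
  have hk : c2 * c5 * m ≠ 0 := mul_ne_zero (mul_ne_zero hc2 hc5) hm0
  have hD0 : ∀ t, D t = 0 := by
    intro t
    rcases le_total 0 (c2 * c5 * m) with h | h
    · exact (mul_eq_zero.1 (eq_zero_of_hasDerivAt_nonneg_of_periodic hT hHd
        (fun t ↦ mul_nonneg h (hDnn t)) hHper t)).resolve_left hk
    · have := eq_zero_of_hasDerivAt_nonneg_of_periodic hT (fun t ↦ (hHd t).neg)
        (fun t ↦ by nlinarith [hDnn t]) (fun t ↦ by simp [hHper t]) t
      exact (mul_eq_zero.1 (neg_eq_zero.1 this)).resolve_left hk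
  have hv0 : ∀ t, (γ t).2 = 0 := fun t ↦ by
    have h1 : 0 < 1 + (γ t).1 ^ 2 + (γ t).2 ^ 2 := by positivity
    simpa [hD, h1.ne', Real.exp_ne_zero] using hD0 t
  refine hne (eq_apply_zero_of_sys160_eq_zero hγ hT hper (t₀ := 0) (Prod.ext ?_ ?_))
  · rw [show γ 0 = ((γ 0).1, (γ 0).2) from rfl, sys160_eq hc1 hm, hv0]
    simp
  · have h := hasDerivAt_snd_comp (hγ 0)
    rw [funext hv0] at h
    exact h.unique (hasDerivAt_const 0 _)

end

/-- For `c₁ ≠ 0` and `c₅c₇ > 0`, the planar system (eq. 160) has no limit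
cycles. -/
theorem stmt18 (c1 c2 c5 c7 : ℝ) (hc1 : c1 ≠ 0) (hc : 0 < c5 * c7) :
    ∀ Γ, ¬ IsLimitCycle2 (sys160 c1 c2 c5 c7) Γ := by
  intro Γ hΓ
  have hc5 : c5 ≠ 0 := left_ne_zero_of_mul hc.ne'
  have hm : c5 + c7 = (c5 + c7) / c1 * c1 := by field_simp
  rcases eq_or_ne c2 0 with rfl | hc2
  · exact not_isLimitCycle2_sys160_of_eq_zero hc1 hm Γ hΓ
  · refine not_isPeriodicOrbit2_sys160 hc1 hm (div_ne_zero (fun h ↦ ?_) hc1) hc5 hc2 Γ hΓ.1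
    rw [eq_neg_of_add_eq_zero_right h] at hc
    nlinarith [sq_nonneg c5]
end

section
/- There exist real numbers a₁, a₂, a₅, a₇, a₈ with a₁ ≠ 0, a₂(a₅+a₇) − a₁a₈ ≠ 0 and a₅a₇ > 0 such that the homogeneous polynomial vector field of degree 2 on S² given by ẋ = a₁xy + a₂y² + a₅yz, ẏ = −a₁x² − a₂xy + a₇xz + a₈yz, ż = −(a₅+a₇)xy − a₈y² has at least one limit cycle on S². In particular, there exist homogeneous polynomial vector fields of degree 2 on S² possessing a limit cycle. -/
/-- The sphere `S² ⊆ ℝ³`. -/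
def S2 : Set (Fin 3 → ℝ) := {p | p 0 ^ 2 + p 1 ^ 2 + p 2 ^ 2 = 1}

/-- `Γ` is a periodic orbit of the vector field `X` on `S²`. -/
def IsPeriodicOrbitOn (X : (Fin 3 → ℝ) → (Fin 3 → ℝ)) (Γ : Set (Fin 3 → ℝ)) : Prop :=
  ∃ (γ : ℝ → Fin 3 → ℝ) (T : ℝ),
    (∀ t, HasDerivAt γ (X (γ t)) t) ∧ 0 < T ∧ (∀ t, γ (t + T) = γ t) ∧
    (¬ ∀ t, γ t = γ 0) ∧ Set.range γ ⊆ S2 ∧ Γ = Set.range γ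

/-- `Γ` is a limit cycle of `X` on `S²`: a periodic orbit isolated in the set of all periodic
orbits of `X` on `S²`. -/
def IsLimitCycleOn (X : (Fin 3 → ℝ) → (Fin 3 → ℝ)) (Γ : Set (Fin 3 → ℝ)) : Prop :=
  IsPeriodicOrbitOn X Γ ∧ ∃ U : Set (Fin 3 → ℝ), IsOpen U ∧ Γ ⊆ U ∧
    ∀ Γ', IsPeriodicOrbitOn X Γ' → Γ' ⊆ U → Γ' = Γ

/-- The family (eq. 142) of degree-2 homogeneous polynomial vector fields on `S²`. -/
def Xfam (a1 a2 a5 a7 a8 : ℝ) (p : Fin 3 → ℝ) : Fin 3 → ℝ :=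
  ![a1 * p 0 * p 1 + a2 * (p 1) ^ 2 + a5 * p 1 * p 2,
    -a1 * (p 0) ^ 2 - a2 * p 0 * p 1 + a7 * p 0 * p 2 + a8 * p 1 * p 2,
    -(a5 + a7) * p 0 * p 1 - a8 * (p 1) ^ 2]

/-- A periodic scalar equation `y' = -c y + h θ y` whose nonlinearity has Lipschitz constant
smaller than `c` has a periodic solution. -/
theorem exists_periodic_solution {c L B p : ℝ} (hp : 0 < p) (hL : 0 ≤ L) (hc : L < c)
    (h : ℝ → ℝ → ℝ) (hcont : Continuous fun q : ℝ × ℝ => h q.1 q.2)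
    (hper : ∀ θ y, h (θ + p) y = h θ y)
    (hlip : ∀ θ y y', |h θ y - h θ y'| ≤ L * |y - y'|) (hB : ∀ θ, |h θ 0| ≤ B) :
    ∃ y : ℝ → ℝ, (∀ θ, HasDerivAt y (-c * y θ + h θ (y θ)) θ) ∧ (∀ θ, y (θ + p) = y θ) ∧
      ∀ θ, |y θ| ≤ B / (c - L) := by
  have hc0 : 0 < c := hL.trans_lt hc
  have hexp : Real.exp (-c * p) < 1 := Real.exp_lt_one_iff.2 (by nlinarith)
  set k : ℝ := 1 / (1 - Real.exp (-c * p)) with hk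
  have hk0 : 0 < k := one_div_pos.2 (by linarith)
  have hkint : k * ∫ τ in (0 : ℝ)..p, Real.exp (-c * τ) = 1 / c := by
    have h1 : ∀ x ∈ Set.uIcc 0 p, HasDerivAt (fun τ => -(1 / c) * Real.exp (-c * τ))
        (Real.exp (-c * x)) x := by
      intro x _
      have := (((hasDerivAt_id x).const_mul (-c)).exp).const_mul (-(1 / c))
      refine this.congr_deriv ?_
      rw [id]
      field_simp
    rw [intervalIntegral.integral_eq_sub_of_hasDerivAt h1
      (Continuous.intervalIntegrable (by fun_prop) _ _), hk]
    have : 1 - Real.exp (-c * p) ≠ 0 := by linarith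
    rw [mul_zero, Real.exp_zero]
    generalize Real.exp (-c * p) = E at this
    field_simp
    ring
  have hcomp : ∀ y : ℝ → ℝ, Continuous y → Continuous fun s => h s (y s) := fun y hy =>
    hcont.comp (continuous_id.prodMk hy)
  have hkbound : ∀ (f : ℝ → ℝ) (C : ℝ), (∀ τ, |f τ| ≤ C) →
      |k * ∫ τ in (0 : ℝ)..p, Real.exp (-c * τ) * f τ| ≤ C / c := by
    intro f C hf
    have h1 : ‖∫ τ in (0 : ℝ)..p, Real.exp (-c * τ) * f τ‖ ≤
        ∫ τ in (0 : ℝ)..p, Real.exp (-c * τ) * C := by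
      refine intervalIntegral.norm_integral_le_of_norm_le hp.le (Filter.Eventually.of_forall ?_)
        (Continuous.intervalIntegrable (by fun_prop) _ _)
      intro τ _
      rw [norm_mul, Real.norm_eq_abs, Real.abs_exp]
      exact mul_le_mul_of_nonneg_left (hf τ) (Real.exp_pos _).le
    rw [intervalIntegral.integral_mul_const] at h1
    rw [abs_mul, abs_of_pos hk0]
    calc k * |∫ τ in (0 : ℝ)..p, Real.exp (-c * τ) * f τ|
        ≤ k * ((∫ τ in (0 : ℝ)..p, Real.exp (-c * τ)) * C) :=
          mul_le_mul_of_nonneg_left h1 hk0.le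
      _ = C / c := by rw [← mul_assoc, hkint]; ring
  let S : (ℝ → ℝ) → ℝ → ℝ := fun y θ =>
    k * ∫ τ in (0 : ℝ)..p, Real.exp (-c * τ) * h (θ - τ) (y (θ - τ))
  have hScont : ∀ y : ℝ → ℝ, Continuous y → Continuous (S y) := by
    intro y hy
    refine continuous_const.mul
      (intervalIntegral.continuous_parametric_intervalIntegral_of_continuous' ?_ 0 p)
    have := (hcomp y hy).comp
      (continuous_fst.sub continuous_snd : Continuous fun q : ℝ × ℝ => q.1 - q.2)
    exact (by fun_prop : Continuous fun q : ℝ × ℝ => Real.exp (-c * q.2)).mul this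
  have hbd : ∀ (C : ℝ) (y : ℝ → ℝ), (∀ θ, |y θ| ≤ C) → ∀ θ, |h θ (y θ)| ≤ B + L * C := by
    intro C y hy θ
    have h1 := hlip θ (y θ) 0
    have h2 := abs_sub_abs_le_abs_sub (h θ (y θ)) (h θ 0)
    have h3 := mul_le_mul_of_nonneg_left (hy θ) hL
    rw [sub_zero] at h1
    linarith [hB θ]
  have hSb : ∀ (C : ℝ) (y : ℝ → ℝ), (∀ θ, |y θ| ≤ C) → ∀ θ, |S y θ| ≤ (B + L * C) / c :=
    fun C y hy θ => hkbound _ _ fun τ => hbd C y hy (θ - τ)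
  let T : BoundedContinuousFunction ℝ ℝ → BoundedContinuousFunction ℝ ℝ := fun y =>
    BoundedContinuousFunction.ofNormedAddCommGroup (S y) (hScont y y.continuous)
      ((B + L * ‖y‖) / c) (hSb ‖y‖ y y.norm_coe_le_norm)
  have hT : ∀ y θ, T y θ = S y θ := fun _ _ => rfl
  have hTc : ContractingWith (L / c).toNNReal T := by
    refine ⟨Real.toNNReal_lt_one.2 ((div_lt_one hc0).2 hc),
      LipschitzWith.of_dist_le_mul fun y z => ?_⟩
    rw [BoundedContinuousFunction.dist_le_iff_of_nonempty]
    intro θ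
    have hi : ∀ w : BoundedContinuousFunction ℝ ℝ, IntervalIntegrable
        (fun τ => Real.exp (-c * τ) * h (θ - τ) (w (θ - τ))) MeasureTheory.volume 0 p := by
      intro w
      have := (hcomp w w.continuous).comp
        (continuous_const.sub continuous_id : Continuous fun q : ℝ => θ - q)
      exact ((by fun_prop : Continuous fun q : ℝ => Real.exp (-c * q)).mul
        this).intervalIntegrable _ _
    rw [hT, hT, Real.dist_eq]
    have : S y θ - S z θ = k * ∫ τ in (0 : ℝ)..p, Real.exp (-c * τ) *
        (h (θ - τ) (y (θ - τ)) - h (θ - τ) (z (θ - τ))) := by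
      simp only [S, mul_sub]
      rw [intervalIntegral.integral_sub (hi y) (hi z), mul_sub]
    rw [this]
    refine (hkbound _ (L * dist y z) fun τ => (hlip _ _ _).trans ?_).trans_eq ?_
    · exact mul_le_mul_of_nonneg_left (y.dist_coe_le_dist (g := z) (θ - τ)) hL
    · rw [Real.coe_toNNReal _ (by positivity)]; ring
  obtain ⟨y, hy⟩ : ∃ y, T y = y := ⟨_, hTc.fixedPoint_isFixedPt⟩
  have hyS : ∀ θ, y θ = S y θ := fun θ => by rw [← hT, hy]
  have hyper : ∀ θ, y (θ + p) = y θ := by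
    let z : BoundedContinuousFunction ℝ ℝ := y.compContinuous ⟨fun θ => θ + p, by fun_prop⟩
    have hz : ∀ θ, z θ = y (θ + p) := fun _ => rfl
    have hzT : T z = z := by
      ext θ
      rw [hT, hz, hyS]
      simp only [S, hz]
      congr 1
      refine intervalIntegral.integral_congr fun τ _ => ?_
      rw [show θ + p - τ = (θ - τ) + p by ring, hper]
    have : z = y := hTc.fixedPoint_unique' hzT hy
    intro θ
    rw [← hz, this]
  refine ⟨y, ?_, hyper, ?_⟩
  · intro θ
    set g : ℝ → ℝ := fun s => Real.exp (c * s) * h s (y s) with hg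
    have hgc : Continuous g :=
      (by fun_prop : Continuous fun s : ℝ => Real.exp (c * s)).mul (hcomp y y.continuous)
    have hrep : ∀ θ, y θ = k * Real.exp (-c * θ) *
        ((∫ s in (0 : ℝ)..θ, g s) - ∫ s in (0 : ℝ)..(θ - p), g s) := by
      intro θ
      rw [hyS, intervalIntegral.integral_interval_sub_left (hgc.intervalIntegrable _ _)
        (hgc.intervalIntegrable _ _)]
      simp only [S]
      rw [mul_assoc, ← intervalIntegral.integral_const_mul (Real.exp (-c * θ))]
      congr 1
      have := intervalIntegral.integral_comp_sub_left (a := 0) (b := p)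
        (fun s => Real.exp (-c * θ) * g s) θ
      rw [sub_zero] at this
      rw [← this]
      refine intervalIntegral.integral_congr fun τ _ => ?_
      simp only [hg]
      rw [← mul_assoc, ← Real.exp_add]
      congr 2
      ring
    have h1 : HasDerivAt (fun θ => ∫ s in (0 : ℝ)..θ, g s) (g θ) θ :=
      (hgc.integral_hasStrictDerivAt 0 θ).hasDerivAt
    have h2 : HasDerivAt (fun θ => ∫ s in (0 : ℝ)..(θ - p), g s) (g (θ - p)) θ := by
      have := (hgc.integral_hasStrictDerivAt 0 (θ - p)).hasDerivAt.comp θ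
        ((hasDerivAt_id θ).sub_const p)
      rw [mul_one] at this
      exact this
    have h3 : HasDerivAt (fun θ => k * Real.exp (-c * θ)) (k * (Real.exp (-c * θ) * -c)) θ := by
      have := (((hasDerivAt_id θ).const_mul (-c)).exp).const_mul k
      simpa using this
    have h4 := h3.mul (h1.sub h2)
    have h5 : g (θ - p) = Real.exp (-c * p) * g θ := by
      have e1 := hper (θ - p) (y (θ - p))
      have e2 := hyper (θ - p)
      rw [sub_add_cancel] at e1 e2
      simp only [hg]
      rw [← e1, ← e2, ← mul_assoc, ← Real.exp_add]
      congr 2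
      ring
    have h6 : k * (1 - Real.exp (-c * p)) = 1 := by
      rw [hk]; exact one_div_mul_cancel (by linarith)
    have h7 : Real.exp (-c * θ) * Real.exp (c * θ) = 1 := by
      rw [← Real.exp_add]; simp
    refine (h4.congr_of_eventuallyEq (Filter.Eventually.of_forall hrep)).congr_deriv ?_
    simp only [Pi.sub_apply]
    rw [h5]
    have h8 : g θ = Real.exp (c * θ) * h θ (y θ) := rfl
    linear_combination c * hrep θ + h θ (y θ) * h6 +
      h θ (y θ) * k * (1 - Real.exp (-c * p)) * h7 +
      k * Real.exp (-c * θ) * (1 - Real.exp (-c * p)) * h8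
  · intro θ
    have h1 : ‖y‖ ≤ (B + L * ‖y‖) / c := by
      rw [BoundedContinuousFunction.norm_le_of_nonempty]
      intro θ
      rw [hyS]
      exact hSb ‖y‖ y y.norm_coe_le_norm θ
    rw [le_div_iff₀ hc0] at h1
    refine (y.norm_coe_le_norm θ).trans ?_
    rw [le_div_iff₀ (by linarith)]
    linarith

theorem strictMono_surjective_of_le_deriv {f f' : ℝ → ℝ} {c : ℝ} (hc : 0 < c)
    (hf : ∀ x, HasDerivAt f (f' x) x) (hle : ∀ x, c ≤ f' x) :
    StrictMono f ∧ Function.Surjective f := by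
  have hmono : Monotone fun x => f x - c * x := by
    refine monotone_of_deriv_nonneg (fun x => ((hf x).sub
      ((hasDerivAt_id x).const_mul c)).differentiableAt) fun x => ?_
    rw [show deriv (fun x => f x - c * x) x = f' x - c * 1 from
      ((hf x).sub ((hasDerivAt_id x).const_mul c)).deriv]
    linarith [hle x]
  have hcont : Continuous f := continuous_iff_continuousAt.2 fun x => (hf x).continuousAt
  refine ⟨fun x y hxy => ?_, hcont.surjective ?_ ?_⟩
  · have := hmono hxy.le
    simp only at this
    nlinarith
  · refine Filter.tendsto_atTop_mono' _ (f₁ := fun x => c * x + f 0) ?_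
      (Filter.tendsto_atTop_add_const_right _ _ (Filter.tendsto_id.const_mul_atTop hc))
    filter_upwards [Filter.eventually_ge_atTop 0] with x hx
    have := hmono hx
    simp only at this
    linarith
  · refine Filter.tendsto_atBot_mono' _ (f₁ := fun x => c * x + f 0) ?_
      (Filter.tendsto_atBot_add_const_right _ _ (Filter.tendsto_id.const_mul_atBot hc))
    filter_upwards [Filter.eventually_le_atBot 0] with x hx
    have := hmono hx
    simp only at this
    linarith

/-- A positive periodic scalar field generates a global solution which gains one period of the
field in a fixed time. -/
theorem exists_solution_add_period {v : ℝ → ℝ} {c C p : ℝ} (hv : Continuous v) (hc : 0 < c)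
    (hcv : ∀ x, c ≤ v x) (hvC : ∀ x, v x ≤ C) (hp : 0 < p) (hper : ∀ x, v (x + p) = v x) :
    ∃ (u : ℝ → ℝ) (T : ℝ), 0 < T ∧ (∀ t, HasDerivAt u (v (u t)) t) ∧
      (∀ t, u (t + T) = u t + p) ∧ Function.Surjective u := by
  have hv0 : ∀ x, 0 < v x := fun x => hc.trans_le (hcv x)
  have hC : 0 < C := (hv0 0).trans_le (hvC 0)
  have hvi : Continuous fun x => (v x)⁻¹ := hv.inv₀ fun x => (hv0 x).ne'
  set τ : ℝ → ℝ := fun x => ∫ s in (0 : ℝ)..x, (v s)⁻¹ with hτ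
  have hτ' : ∀ x, HasDerivAt τ (v x)⁻¹ x := fun x =>
    (hvi.integral_hasStrictDerivAt 0 x).hasDerivAt
  obtain ⟨hsm, hsurj⟩ := strictMono_surjective_of_le_deriv (inv_pos.2 hC) hτ' fun x =>
    inv_anti₀ (hv0 x) (hvC x)
  have hadd : ∀ x, τ (x + p) = τ x + τ p := by
    intro x
    have hII : ∀ a b, IntervalIntegrable (fun x => (v x)⁻¹) MeasureTheory.volume a b :=
      fun a b => hvi.intervalIntegrable a b
    have hP : Function.Periodic (fun x => (v x)⁻¹) p := fun x => by simp only [hper]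
    have h1 := hP.intervalIntegral_add_eq x 0
    rw [zero_add] at h1
    simp only [hτ]
    rw [← h1, intervalIntegral.integral_add_adjacent_intervals (hII _ _) (hII _ _)]
  let e : ℝ ≃o ℝ := hsm.orderIsoOfSurjective τ hsurj
  have he : ∀ x, e x = τ x := fun _ => rfl
  refine ⟨e.symm, τ p, ?_, ?_, ?_, e.symm.surjective⟩
  · have := hsm hp
    simpa [hτ] using this
  · intro t
    have := HasDerivAt.of_local_left_inverse (f := τ) (g := e.symm) (a := t)
      e.symm.continuous.continuousAt (hτ' (e.symm t)) (inv_pos.2 (hv0 _)).ne'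
      (Filter.Eventually.of_forall fun s => e.apply_symm_apply s)
    rwa [inv_inv] at this
  · intro t
    apply e.injective
    rw [e.apply_symm_apply, he, hadd, ← he, ← he, e.apply_symm_apply]

/-- Unit vectors rotating with angular speed `ν` are described by an angle. -/
theorem exists_angle {a b ν : ℝ → ℝ} (hν : Continuous ν)
    (ha : ∀ t, HasDerivAt a (-(ν t) * b t) t) (hb : ∀ t, HasDerivAt b (ν t * a t) t)
    (h1 : a 0 ^ 2 + b 0 ^ 2 = 1) :
    ∃ Θ : ℝ → ℝ, (∀ t, HasDerivAt Θ (ν t) t) ∧ (∀ t, a t = Real.cos (Θ t)) ∧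
      ∀ t, b t = Real.sin (Θ t) := by
  obtain ⟨θ₀, ha0, hb0⟩ : ∃ θ, a 0 = Real.cos θ ∧ b 0 = Real.sin θ := by
    set z : ℂ := ⟨a 0, b 0⟩
    have hz : ‖z‖ = 1 := by
      rw [← sq_eq_sq₀ (norm_nonneg _) zero_le_one, Complex.sq_norm, Complex.normSq_mk]
      linarith
    refine ⟨z.arg, ?_, ?_⟩
    · rw [Complex.cos_arg (by rintro h; simp [h] at hz), hz, div_one]
    · rw [Complex.sin_arg, hz, div_one]
  set Θ : ℝ → ℝ := fun t => θ₀ + ∫ s in (0 : ℝ)..t, ν s with hΘ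
  have hΘ' : ∀ t, HasDerivAt Θ (ν t) t := fun t =>
    (hν.integral_hasStrictDerivAt 0 t).hasDerivAt.const_add θ₀
  have hΘ0 : Θ 0 = θ₀ := by simp [hΘ]
  have hA : ∀ t, a t * Real.cos (Θ t) + b t * Real.sin (Θ t) = 1 := by
    have hd : ∀ t, HasDerivAt (fun t => a t * Real.cos (Θ t) + b t * Real.sin (Θ t)) 0 t := by
      intro t
      refine (((ha t).mul (hΘ' t).cos).add ((hb t).mul (hΘ' t).sin)).congr_deriv ?_
      ring
    intro t
    have := is_const_of_deriv_eq_zero (fun t => (hd t).differentiableAt) (fun t => (hd t).deriv) t 0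
    rw [this, hΘ0, ← ha0, ← hb0]
    linarith
  have hB : ∀ t, b t * Real.cos (Θ t) - a t * Real.sin (Θ t) = 0 := by
    have hd : ∀ t, HasDerivAt (fun t => b t * Real.cos (Θ t) - a t * Real.sin (Θ t)) 0 t := by
      intro t
      refine (((hb t).mul (hΘ' t).cos).sub ((ha t).mul (hΘ' t).sin)).congr_deriv ?_
      ring
    intro t
    have := is_const_of_deriv_eq_zero (fun t => (hd t).differentiableAt) (fun t => (hd t).deriv) t 0
    rw [this, hΘ0, ← ha0, ← hb0]
    ring
  refine ⟨Θ, hΘ', fun t => ?_, fun t => ?_⟩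
  · linear_combination Real.cos (Θ t) * hA t - Real.sin (Θ t) * hB t -
      a t * Real.sin_sq_add_cos_sq (Θ t)
  · linear_combination Real.sin (Θ t) * hA t + Real.cos (Θ t) * hB t -
      b t * Real.sin_sq_add_cos_sq (Θ t)

theorem apply_eq_of_cos_sin_eq {E : Type*} {f : ℝ → E} (hf : Function.Periodic f (2 * Real.pi))
    {a b : ℝ} (hc : Real.cos a = Real.cos b) (hs : Real.sin a = Real.sin b) : f a = f b := by
  have h := Real.Angle.cos_sin_inj hc hs
  obtain ⟨n, hn⟩ := Real.Angle.angle_eq_iff_two_pi_dvd_sub.1 h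
  rw [show a = b + n * (2 * Real.pi) by linarith]
  exact hf.int_mul n b

/-- The slope `dω/dθ`, up to the factor `ε`, of the perturbed field in the coordinates
`θ` (longitude) and `ω` (cotangent of the colatitude). -/
noncomputable def cotSlope (ε θ ω : ℝ) : ℝ :=
  (1 + ω ^ 2) * (8 * Real.cos θ ^ 2 - 5) / (ω * (1 + 8 * ε * Real.cos θ * Real.sin θ) - Real.cos θ)

/-- The derivative of `cotSlope 0 θ` at `5 / 4`. -/
noncomputable def cotSlopeDeriv (θ : ℝ) : ℝ :=
  (8 * Real.cos θ ^ 2 - 5) * (9 / 16 - 5 / 2 * Real.cos θ) / (5 / 4 - Real.cos θ) ^ 2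

/-- A periodic primitive of `cotSlope 0 · (5 / 4)`. -/
noncomputable def cotSlopePrim (θ : ℝ) : ℝ :=
  41 / 16 * (-8 * Real.sin θ + 20 * Real.arctan (Real.sin θ / (2 - Real.cos θ)))

/-- A periodic primitive of `cotSlopeDeriv + 82 / 9`. -/
noncomputable def cotSlopeDerivPrim (θ : ℝ) : ℝ :=
  -20 * Real.sin θ + 655 / 9 * Real.arctan (Real.sin θ / (2 - Real.cos θ)) -
    205 / 6 * (Real.sin θ / (5 / 4 - Real.cos θ))

theorem cotSlopePrim_periodic : Function.Periodic cotSlopePrim (2 * Real.pi) := fun θ => by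
  simp only [cotSlopePrim, Real.sin_add_two_pi, Real.cos_add_two_pi]

theorem cotSlopeDerivPrim_periodic :
    Function.Periodic cotSlopeDerivPrim (2 * Real.pi) := fun θ => by
  simp only [cotSlopeDerivPrim, Real.sin_add_two_pi, Real.cos_add_two_pi]

theorem hasDerivAt_arctan_sin_div (θ : ℝ) :
    HasDerivAt (fun θ => Real.arctan (Real.sin θ / (2 - Real.cos θ)))
      ((2 * Real.cos θ - 1) / (5 - 4 * Real.cos θ)) θ := by
  have hc := Real.cos_le_one θ
  have h2 : (2 : ℝ) - Real.cos θ ≠ 0 := by linarith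
  have h5 : (5 : ℝ) - 4 * Real.cos θ ≠ 0 := by linarith
  refine (((Real.hasDerivAt_sin θ).div
    ((Real.hasDerivAt_cos θ).const_sub 2) h2).arctan).congr_deriv ?_
  have hs : Real.sin θ ^ 2 = 1 - Real.cos θ ^ 2 := by linarith [Real.sin_sq_add_cos_sq θ]
  have h1 : 1 + (Real.sin θ / (2 - Real.cos θ)) ^ 2 =
      (5 - 4 * Real.cos θ) / (2 - Real.cos θ) ^ 2 := by
    rw [div_pow, hs]; field_simp; ring
  simp only [Pi.div_apply, h1]
  field_simp
  linear_combination (-1) * hs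

theorem hasDerivAt_cotSlopePrim (θ : ℝ) : HasDerivAt cotSlopePrim (cotSlope 0 θ (5 / 4)) θ := by
  have hc := Real.cos_le_one θ
  have h5 : (5 : ℝ) - 4 * Real.cos θ ≠ 0 := by linarith
  refine ((((Real.hasDerivAt_sin θ).const_mul (-8)).add
    ((hasDerivAt_arctan_sin_div θ).const_mul 20)).const_mul (41 / 16)).congr_deriv ?_
  rw [cotSlope, show (5 / 4 : ℝ) * (1 + 8 * 0 * Real.cos θ * Real.sin θ) - Real.cos θ =
    (5 - 4 * Real.cos θ) / 4 by ring]
  obtain ⟨D, hD⟩ : ∃ D, D = 5 - 4 * Real.cos θ := ⟨_, rfl⟩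
  rw [← hD] at h5 ⊢
  rw [show Real.cos θ = (5 - D) / 4 by linarith]
  field_simp
  ring

theorem hasDerivAt_cotSlopeDerivPrim (θ : ℝ) :
    HasDerivAt cotSlopeDerivPrim (cotSlopeDeriv θ + 82 / 9) θ := by
  have hc := Real.cos_le_one θ
  have h4 : (5 / 4 : ℝ) - Real.cos θ ≠ 0 := by linarith
  have h5 : (5 : ℝ) - 4 * Real.cos θ ≠ 0 := by linarith
  refine ((((Real.hasDerivAt_sin θ).const_mul (-20)).add
    ((hasDerivAt_arctan_sin_div θ).const_mul (655 / 9))).sub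
    (((Real.hasDerivAt_sin θ).div ((Real.hasDerivAt_cos θ).const_sub (5 / 4)) h4).const_mul
      (205 / 6))).congr_deriv ?_
  have hs : Real.sin θ * Real.sin θ = 1 - Real.cos θ ^ 2 := by
    linarith [Real.sin_sq_add_cos_sq θ]
  simp only [neg_neg, hs, cotSlopeDeriv]
  generalize Real.cos θ = c at *
  rw [show (5 / 4 : ℝ) - c = (5 - 4 * c) / 4 by ring]
  obtain ⟨D, rfl⟩ : ∃ D, c = (5 - D) / 4 := ⟨5 - 4 * c, by ring⟩
  have hD : 5 - 4 * ((5 - D) / 4) = D := by ring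
  rw [hD] at h5 ⊢
  field_simp
  ring

theorem abs_eight_cos_sq_sub_five_le (θ : ℝ) : |8 * Real.cos θ ^ 2 - 5| ≤ 5 := by
  rw [abs_le]
  constructor <;> nlinarith [Real.cos_sq_le_one θ, sq_nonneg (Real.cos θ)]

theorem abs_cotSlopePrim_le (θ : ℝ) : |cotSlopePrim θ| ≤ 123 := by
  have h1 := Real.neg_pi_div_two_lt_arctan (Real.sin θ / (2 - Real.cos θ))
  have h2 := Real.arctan_lt_pi_div_two (Real.sin θ / (2 - Real.cos θ))
  have h3 := Real.neg_one_le_sin θ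
  have h4 := Real.sin_le_one θ
  have h5 := Real.pi_le_four
  rw [cotSlopePrim, abs_le]
  constructor <;> linarith

theorem abs_cotSlopeDerivPrim_le (θ : ℝ) : |cotSlopeDerivPrim θ| ≤ 400 := by
  have h1 := Real.neg_pi_div_two_lt_arctan (Real.sin θ / (2 - Real.cos θ))
  have h2 := Real.arctan_lt_pi_div_two (Real.sin θ / (2 - Real.cos θ))
  have h3 := Real.neg_one_le_sin θ
  have h4 := Real.sin_le_one θ
  have h5 := Real.pi_le_four
  have h6 := Real.cos_le_one θ
  have h7 : -4 ≤ Real.sin θ / (5 / 4 - Real.cos θ) := by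
    rw [le_div_iff₀ (by linarith)]; linarith
  have h8 : Real.sin θ / (5 / 4 - Real.cos θ) ≤ 4 := by
    rw [div_le_iff₀ (by linarith)]; linarith
  rw [cotSlopeDerivPrim, abs_le]
  constructor <;> linarith

theorem abs_cotSlopeDeriv_le (θ : ℝ) : |cotSlopeDeriv θ| ≤ 246 := by
  have h6 := Real.cos_le_one θ
  have h7 := Real.neg_one_le_cos θ
  rw [cotSlopeDeriv, abs_div, abs_mul, abs_of_nonneg (sq_nonneg (5 / 4 - Real.cos θ)),
    div_le_iff₀ (by nlinarith)]
  have h1 : |9 / 16 - 5 / 2 * Real.cos θ| ≤ 49 / 16 := by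
    rw [abs_le]; constructor <;> linarith
  have h2 := mul_le_mul (abs_eight_cos_sq_sub_five_le θ) h1 (abs_nonneg _) (by norm_num)
  nlinarith

theorem abs_cotSlope_sub_cotSlope_zero_le {ε θ : ℝ} (hε : 0 ≤ ε)
    (h : 1 / 8 ≤ 5 / 4 * (1 + 8 * ε * Real.cos θ * Real.sin θ) - Real.cos θ) :
    |cotSlope ε θ (5 / 4) - cotSlope 0 θ (5 / 4)| ≤ 4100 * ε := by
  have h6 := Real.cos_le_one θ
  have h7 : 0 < 5 / 4 - Real.cos θ := by linarith
  have h8 : 0 < 5 / 4 * (1 + 8 * ε * Real.cos θ * Real.sin θ) - Real.cos θ := by linarith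
  have hid : cotSlope ε θ (5 / 4) - cotSlope 0 θ (5 / 4) =
      -(41 / 16 * 10) * ε * ((8 * Real.cos θ ^ 2 - 5) * (Real.cos θ * Real.sin θ)) /
        ((5 / 4 * (1 + 8 * ε * Real.cos θ * Real.sin θ) - Real.cos θ) * (5 / 4 - Real.cos θ)) := by
    rw [cotSlope, cotSlope, show (5 / 4 : ℝ) * (1 + 8 * 0 * Real.cos θ * Real.sin θ) - Real.cos θ =
      5 / 4 - Real.cos θ by ring, div_sub_div _ _ h8.ne' h7.ne']
    congr 1
    ring
  rw [hid, abs_div, abs_of_pos (mul_pos h8 h7), div_le_iff₀ (mul_pos h8 h7)]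
  have h9 : |Real.cos θ * Real.sin θ| ≤ 1 := by
    rw [abs_mul]
    exact mul_le_one₀ (Real.abs_cos_le_one θ) (abs_nonneg _) (Real.abs_sin_le_one θ)
  have h10 : |(8 * Real.cos θ ^ 2 - 5) * (Real.cos θ * Real.sin θ)| ≤ 5 * 1 := by
    rw [abs_mul]
    exact mul_le_mul (abs_eight_cos_sq_sub_five_le θ) h9 (abs_nonneg _) (by norm_num)
  have h11 : 1 / 8 * (1 / 4) ≤ (5 / 4 * (1 + 8 * ε * Real.cos θ * Real.sin θ) - Real.cos θ) *
      (5 / 4 - Real.cos θ) := mul_le_mul h (by linarith) (by norm_num) h8.le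
  rw [abs_mul, abs_mul, abs_of_nonneg hε, abs_neg,
    abs_of_pos (by norm_num : (0 : ℝ) < 41 / 16 * 10)]
  nlinarith [mul_le_mul_of_nonneg_left h10 hε, mul_le_mul_of_nonneg_left h11 hε]

theorem exists_cotSlope_estimate : ∃ δ : ℝ, 0 < δ ∧ δ ≤ 1 ∧ ∀ ε ω₁ ω₂ : ℝ, |ε| ≤ δ →
    |ω₁ - 5 / 4| ≤ δ → |ω₂ - 5 / 4| ≤ δ → ∀ θ,
      1 / 8 ≤ ω₁ * (1 + 8 * ε * Real.cos θ * Real.sin θ) - Real.cos θ ∧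
      |cotSlope ε θ ω₂ - cotSlope ε θ ω₁ - cotSlopeDeriv θ * (ω₂ - ω₁)| ≤ 4 * |ω₂ - ω₁| := by
  let den : ℝ → ℝ → ℝ × ℝ → ℝ := fun ε ω q => ω * (1 + 8 * ε * q.1 * q.2) - q.1
  let Q : ℝ × ℝ × ℝ → ℝ × ℝ → ℝ := fun x q =>
    (8 * q.1 ^ 2 - 5) * ((1 + 8 * x.1 * q.1 * q.2) * (x.2.1 * x.2.2 - 1) -
      q.1 * (x.2.1 + x.2.2)) / (den x.1 x.2.1 q * den x.1 x.2.2 q)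
  let x₀ : ℝ × ℝ × ℝ := (0, 5 / 4, 5 / 4)
  have hK : IsCompact (Set.Icc (-1 : ℝ) 1 ×ˢ Set.Icc (-1 : ℝ) 1) :=
    isCompact_Icc.prod isCompact_Icc
  have key : ∀ᶠ x in nhds x₀, ∀ q ∈ Set.Icc (-1 : ℝ) 1 ×ˢ Set.Icc (-1 : ℝ) 1,
      1 / 8 < den x.1 x.2.1 q ∧ 1 / 8 < den x.1 x.2.2 q ∧ |Q x q - Q x₀ q| < 4 := by
    refine hK.eventually_forall_of_forall_eventually fun q hq => ?_
    have hq1 : q.1 ≤ 1 := hq.1.2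
    have hd1 : Continuous fun z : (ℝ × ℝ × ℝ) × (ℝ × ℝ) => den z.1.1 z.1.2.1 z.2 := by fun_prop
    have hd2 : Continuous fun z : (ℝ × ℝ × ℝ) × (ℝ × ℝ) => den z.1.1 z.1.2.2 z.2 := by fun_prop
    have hp1 : 1 / 8 < den x₀.1 x₀.2.1 q := by simp only [den, x₀]; linarith
    have hp2 : 1 / 8 < den x₀.1 x₀.2.2 q := by simp only [den, x₀]; linarith
    have hn : den x₀.1 x₀.2.1 q * den x₀.1 x₀.2.2 q ≠ 0 := by nlinarith
    have hQ : ContinuousAt (fun z : (ℝ × ℝ × ℝ) × (ℝ × ℝ) => |Q z.1 z.2 - Q x₀ z.2|) (x₀, q) := by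
      refine (ContinuousAt.sub ?_ ?_).abs
      · exact ContinuousAt.div (by fun_prop) (by fun_prop) hn
      · exact ContinuousAt.div (by fun_prop) (by fun_prop) hn
    filter_upwards [hd1.continuousAt.eventually (lt_mem_nhds hp1),
      hd2.continuousAt.eventually (lt_mem_nhds hp2),
      hQ.eventually (gt_mem_nhds (show |Q x₀ q - Q x₀ q| < 4 by simp))] with z h1 h2 h3
    exact ⟨h1, h2, h3⟩
  obtain ⟨r, hr, hball⟩ := Metric.eventually_nhds_iff.1 key
  refine ⟨min (r / 2) 1, by positivity, min_le_right _ _, ?_⟩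
  intro ε ω₁ ω₂ hε h₁ h₂ θ
  have hlt : min (r / 2) 1 < r := (min_le_left _ _).trans_lt (by linarith)
  have hdist : dist ((ε, ω₁, ω₂) : ℝ × ℝ × ℝ) x₀ < r := by
    rw [Prod.dist_eq, Prod.dist_eq, max_lt_iff, max_lt_iff, Real.dist_eq, Real.dist_eq,
      Real.dist_eq]
    refine ⟨?_, h₁.trans_lt hlt, h₂.trans_lt hlt⟩
    simpa [x₀] using hε.trans_lt hlt
  obtain ⟨hd1, hd2, hQ⟩ := hball hdist (Real.cos θ, Real.sin θ)
    ⟨Real.cos_mem_Icc θ, Real.sin_mem_Icc θ⟩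
  refine ⟨hd1.le, ?_⟩
  have hQ0 : Q x₀ (Real.cos θ, Real.sin θ) = cotSlopeDeriv θ := by
    simp only [Q, x₀, den, cotSlopeDeriv]
    ring_nf
  have hdiff : cotSlope ε θ ω₂ - cotSlope ε θ ω₁ =
      Q (ε, ω₁, ω₂) (Real.cos θ, Real.sin θ) * (ω₂ - ω₁) := by
    simp only [den] at hd1 hd2
    simp only [Q, den, cotSlope]
    rw [div_sub_div _ _ (by linarith) (by linarith), div_mul_eq_mul_div]
    congr 1 <;> ring
  rw [hdiff, ← hQ0, ← sub_mul, abs_mul]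
  exact mul_le_mul_of_nonneg_right hQ.le (abs_nonneg _)

theorem abs_max_min_sub_le (η y y' : ℝ) :
    |max (-η) (min y η) - max (-η) (min y' η)| ≤ |y - y'| := by
  refine (abs_max_sub_max_le_max _ _ _ _).trans ?_
  rw [sub_self, abs_zero, max_eq_right (abs_nonneg _)]
  refine (abs_min_sub_min_le_max _ _ _ _).trans ?_
  simp

theorem exists_periodic_cotSlope_solution {δ ε : ℝ} (hδ : δ ≤ 1)
    (hest : ∀ ε ω₁ ω₂ : ℝ, |ε| ≤ δ → |ω₁ - 5 / 4| ≤ δ → |ω₂ - 5 / 4| ≤ δ → ∀ θ,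
      1 / 8 ≤ ω₁ * (1 + 8 * ε * Real.cos θ * Real.sin θ) - Real.cos θ ∧
      |cotSlope ε θ ω₂ - cotSlope ε θ ω₁ - cotSlopeDeriv θ * (ω₂ - ω₁)| ≤ 4 * |ω₂ - ω₁|)
    (hε : 0 < ε) (hεδ : 10 ^ 6 * ε ≤ δ) :
    ∃ W : ℝ → ℝ, (∀ θ, HasDerivAt W (ε * cotSlope ε θ (W θ)) θ) ∧
      Function.Periodic W (2 * Real.pi) ∧ ∀ θ, |W θ - 5 / 4| < δ := by
  have hδ0 : 0 < δ := by linarith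
  have hε' : |ε| ≤ δ := by rw [abs_of_pos hε]; linarith
  let η : ℝ := δ / 8
  have hη : η = δ / 8 := rfl
  let G : ℝ → ℝ := fun θ => Real.exp (ε * cotSlopeDerivPrim θ)
  have hG0 : ∀ θ, 0 < G θ := fun θ => Real.exp_pos _
  have hM : ∀ θ, |ε * cotSlopeDerivPrim θ| ≤ 1 / 2 := by
    intro θ
    rw [abs_mul, abs_of_pos hε]
    nlinarith [mul_le_mul_of_nonneg_left (abs_cotSlopeDerivPrim_le θ) hε.le]
  have hG2 : ∀ θ, G θ ≤ 2 := by
    intro θ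
    have h1 := Real.add_one_le_exp (-(ε * cotSlopeDerivPrim θ))
    have h2 : G θ * Real.exp (-(ε * cotSlopeDerivPrim θ)) = 1 := by
      simp only [G]
      rw [← Real.exp_add, add_neg_cancel, Real.exp_zero]
    have h3 := (abs_le.1 (hM θ)).2
    nlinarith [hG0 θ]
  have hGi : ∀ θ, (G θ)⁻¹ ≤ 2 := by
    intro θ
    have h1 := Real.add_one_le_exp (ε * cotSlopeDerivPrim θ)
    have h3 := (abs_le.1 (hM θ)).1
    rw [show (2 : ℝ) = (1 / 2)⁻¹ by norm_num]
    exact inv_anti₀ (by norm_num) (by simp only [G]; linarith)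
  let cl : ℝ → ℝ := fun y => max (-η) (min y η)
  have hclη : ∀ y, |cl y| ≤ η := by
    intro y
    rw [abs_le]
    exact ⟨le_max_left _ _, max_le (by simp only [η]; linarith) (min_le_right _ _)⟩
  let Wc : ℝ → ℝ → ℝ := fun θ y => 5 / 4 + ε * cotSlopePrim θ + G θ * cl y
  have hWc : ∀ θ y, |Wc θ y - 5 / 4| ≤ δ / 2 := by
    intro θ y
    have h1 := abs_add_le (ε * cotSlopePrim θ) (G θ * cl y)
    have h2 : |ε * cotSlopePrim θ| ≤ ε * 123 := by
      rw [abs_mul, abs_of_pos hε]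
      exact mul_le_mul_of_nonneg_left (abs_cotSlopePrim_le θ) hε.le
    have h3 : |G θ * cl y| ≤ 2 * η := by
      rw [abs_mul, abs_of_pos (hG0 θ)]
      exact mul_le_mul (hG2 θ) (hclη y) (abs_nonneg _) (by norm_num)
    rw [show Wc θ y - 5 / 4 = ε * cotSlopePrim θ + G θ * cl y by simp only [Wc]; ring]
    linarith
  have hWcδ : ∀ θ y, |Wc θ y - 5 / 4| ≤ δ := fun θ y => (hWc θ y).trans (by linarith)
  have h54 : |(5 / 4 : ℝ) - 5 / 4| ≤ δ := by simpa using hδ0.le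
  let h : ℝ → ℝ → ℝ := fun θ y => ε * (G θ)⁻¹ * (cotSlope ε θ (Wc θ y) - cotSlope 0 θ (5 / 4) -
    cotSlopeDeriv θ * (Wc θ y - 5 / 4) + ε * cotSlopeDeriv θ * cotSlopePrim θ)
  have hΦc : Continuous cotSlopePrim :=
    continuous_iff_continuousAt.2 fun θ => (hasDerivAt_cotSlopePrim θ).continuousAt
  have hMc : Continuous cotSlopeDerivPrim :=
    continuous_iff_continuousAt.2 fun θ => (hasDerivAt_cotSlopeDerivPrim θ).continuousAt
  have hGc : Continuous G := Real.continuous_exp.comp (continuous_const.mul hMc)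
  have hmc : Continuous cotSlopeDeriv := by
    refine Continuous.div (by fun_prop) (by fun_prop) fun θ => ?_
    have := Real.cos_le_one θ
    have : (5 / 4 : ℝ) - Real.cos θ ≠ 0 := by linarith
    positivity
  have hclc : Continuous cl := by simp only [cl]; fun_prop
  have hWcc : Continuous fun q : ℝ × ℝ => Wc q.1 q.2 := by simp only [Wc]; fun_prop
  have hcont : Continuous fun q : ℝ × ℝ => h q.1 q.2 := by
    have hF : Continuous fun q : ℝ × ℝ => cotSlope ε q.1 (Wc q.1 q.2) := by
      refine Continuous.div (by fun_prop) (by fun_prop) fun q => ?_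
      have := (hest ε _ _ hε' (hWcδ q.1 q.2) h54 q.1).1
      linarith
    have hF0 : Continuous fun q : ℝ × ℝ => cotSlope 0 q.1 (5 / 4) := by
      refine Continuous.div (by fun_prop) (by fun_prop) fun q => ?_
      have := (hest 0 _ _ (by simpa using hδ0.le) h54 h54 q.1).1
      linarith
    have hGic : Continuous fun q : ℝ × ℝ => (G q.1)⁻¹ :=
      (hGc.comp continuous_fst).inv₀ fun q => (hG0 q.1).ne'
    simp only [h]
    fun_prop
  have hper : ∀ θ y, h (θ + 2 * Real.pi) y = h θ y := by
    intro θ y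
    have hm : cotSlopeDeriv (θ + 2 * Real.pi) = cotSlopeDeriv θ := by
      simp only [cotSlopeDeriv, Real.cos_add_two_pi]
    have hF : ∀ ε ω, cotSlope ε (θ + 2 * Real.pi) ω = cotSlope ε θ ω := by
      intro ε ω
      simp only [cotSlope, Real.cos_add_two_pi, Real.sin_add_two_pi]
    simp only [h, Wc, G, hm, hF, cotSlopePrim_periodic θ, cotSlopeDerivPrim_periodic θ]
  have hlip : ∀ θ y y', |h θ y - h θ y'| ≤ 4 * ε * |y - y'| := by
    intro θ y y'
    have h1 := (hest ε _ _ hε' (hWcδ θ y') (hWcδ θ y) θ).2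
    have h2 : Wc θ y - Wc θ y' = G θ * (cl y - cl y') := by simp only [Wc]; ring
    have h3 : h θ y - h θ y' = ε * (G θ)⁻¹ * (cotSlope ε θ (Wc θ y) - cotSlope ε θ (Wc θ y') -
        cotSlopeDeriv θ * (Wc θ y - Wc θ y')) := by simp only [h]; ring
    have hGinv := inv_pos.2 (hG0 θ)
    rw [h3, abs_mul, abs_of_pos (mul_pos hε hGinv)]
    calc _ ≤ ε * (G θ)⁻¹ * (4 * |Wc θ y - Wc θ y'|) :=
          mul_le_mul_of_nonneg_left h1 (mul_pos hε hGinv).le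
      _ = 4 * ε * |cl y - cl y'| := by
          rw [h2, abs_mul, abs_of_pos (hG0 θ)]
          have := (hG0 θ).ne'
          field_simp
      _ ≤ _ := mul_le_mul_of_nonneg_left (abs_max_min_sub_le η y y') (by linarith)
  have hB : ∀ θ, |h θ 0| ≤ 70000 * ε ^ 2 := by
    intro θ
    have hcl0 : cl 0 = 0 := by
      simp only [cl]
      rw [min_eq_left (by simp only [η]; linarith), max_eq_right (by simp only [η]; linarith)]
    have hW0 : Wc θ 0 - 5 / 4 = ε * cotSlopePrim θ := by simp only [Wc, hcl0]; ring
    have h1 := (hest ε _ _ hε' h54 (hWcδ θ 0) θ)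
    have h2 := abs_cotSlope_sub_cotSlope_zero_le hε.le h1.1
    have h1 := h1.2
    have h3 : |ε * cotSlopePrim θ| ≤ ε * 123 := by
      rw [abs_mul, abs_of_pos hε]
      exact mul_le_mul_of_nonneg_left (abs_cotSlopePrim_le θ) hε.le
    have h4 : |ε * cotSlopeDeriv θ * cotSlopePrim θ| ≤ ε * 246 * 123 := by
      rw [abs_mul, abs_mul, abs_of_pos hε]
      exact mul_le_mul (mul_le_mul_of_nonneg_left (abs_cotSlopeDeriv_le θ) hε.le)
        (abs_cotSlopePrim_le θ) (abs_nonneg _) (by positivity)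
    rw [hW0] at h1
    have h5 : |cotSlope ε θ (Wc θ 0) - cotSlope 0 θ (5 / 4) -
        cotSlopeDeriv θ * (Wc θ 0 - 5 / 4) + ε * cotSlopeDeriv θ * cotSlopePrim θ| ≤
        34850 * ε := by
      rw [hW0]
      have a1 := abs_le.1 h1
      have a2 := abs_le.1 h2
      have a4 := abs_le.1 h4
      rw [abs_le]
      constructor <;> linarith
    have hGinv := inv_pos.2 (hG0 θ)
    simp only [h]
    rw [abs_mul, abs_of_pos (mul_pos hε hGinv)]
    calc _ ≤ ε * 2 * (34850 * ε) := mul_le_mul (mul_le_mul_of_nonneg_left (hGi θ) hε.le) h5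
            (abs_nonneg _) (by positivity)
      _ ≤ _ := by nlinarith
  obtain ⟨y, hy, hyper, hyB⟩ := exists_periodic_solution (c := ε * (82 / 9)) (L := 4 * ε)
    (B := 70000 * ε ^ 2) Real.two_pi_pos (by linarith) (by linarith) h hcont hper hlip hB
  have hcly : ∀ θ, cl (y θ) = y θ := by
    intro θ
    have h1 : |y θ| ≤ η := by
      refine (hyB θ).trans ?_
      rw [div_le_iff₀ (by linarith)]
      nlinarith
    simp only [cl]
    rw [min_eq_left (abs_le.1 h1).2, max_eq_right (abs_le.1 h1).1]
  have hWeq : ∀ θ, Wc θ (y θ) = 5 / 4 + ε * cotSlopePrim θ + G θ * y θ := by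
    intro θ
    simp only [Wc, hcly]
  refine ⟨fun θ => Wc θ (y θ), fun θ => ?_, fun θ => ?_, fun θ => (hWc θ _).trans_lt (by linarith)⟩
  · have hGd : HasDerivAt G (G θ * (ε * (cotSlopeDeriv θ + 82 / 9))) θ :=
      ((hasDerivAt_cotSlopeDerivPrim θ).const_mul ε).exp
    have hd := (((hasDerivAt_cotSlopePrim θ).const_mul ε).const_add (5 / 4)).add (hGd.mul (hy θ))
    refine (hd.congr_of_eventuallyEq (Filter.Eventually.of_forall hWeq)).congr_deriv ?_
    simp only [h]
    have := (hG0 θ).ne'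
    rw [hWeq]
    field_simp
    ring
  · simp only [Wc, G, hyper, cotSlopePrim_periodic θ, cotSlopeDerivPrim_periodic θ]

/-- A quadratic vector field on the sphere close to the degenerate field with a line of
equilibria. -/
def modelField (ε : ℝ) (p : Fin 3 → ℝ) : Fin 3 → ℝ :=
  ![p 0 * p 1 - p 1 * p 2 - 3 * ε * p 0 * p 2, p 0 * p 2 - p 0 ^ 2 + 5 * ε * p 1 * p 2,
    ε * (3 * p 0 ^ 2 - 5 * p 1 ^ 2)]

/-- The point of the sphere with longitude `θ` whose colatitude has cotangent `ω`. -/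
noncomputable def spherePoint (ω θ : ℝ) : Fin 3 → ℝ :=
  ![Real.cos θ / √(1 + ω ^ 2), Real.sin θ / √(1 + ω ^ 2), ω / √(1 + ω ^ 2)]

theorem spherePoint_mem_S2 (ω θ : ℝ) : spherePoint ω θ ∈ S2 := by
  have h : √(1 + ω ^ 2) ^ 2 = 1 + ω ^ 2 := Real.sq_sqrt (by positivity)
  have h0 : √(1 + ω ^ 2) ≠ 0 := by positivity
  simp only [S2, spherePoint, Set.mem_ofPred_eq, Matrix.cons_val_zero, Matrix.cons_val_one,
    Matrix.cons_val]
  field_simp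
  linarith [Real.sin_sq_add_cos_sq θ]

theorem hasDerivAt_spherePoint {ε : ℝ} {ω Θ : ℝ → ℝ} {t : ℝ}
    (hΘ : HasDerivAt Θ ((ω t * (1 + 8 * ε * Real.cos (Θ t) * Real.sin (Θ t)) - Real.cos (Θ t)) /
      √(1 + ω t ^ 2)) t)
    (hω : HasDerivAt ω (ε * √(1 + ω t ^ 2) * (8 * Real.cos (Θ t) ^ 2 - 5)) t) :
    HasDerivAt (fun t => spherePoint (ω t) (Θ t)) (modelField ε (spherePoint (ω t) (Θ t))) t := by
  have h : √(1 + ω t ^ 2) ^ 2 = 1 + ω t ^ 2 := Real.sq_sqrt (by positivity)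
  have h0 : √(1 + ω t ^ 2) ≠ 0 := by positivity
  have hr := ((hω.pow 2).const_add 1).sqrt (show 1 + ω t ^ 2 ≠ 0 by positivity)
  have hs : Real.sin (Θ t) ^ 2 = 1 - Real.cos (Θ t) ^ 2 := by
    linarith [Real.sin_sq_add_cos_sq (Θ t)]
  have hx := hΘ.cos.div hr h0
  have hy := hΘ.sin.div hr h0
  have hz := hω.div hr h0
  rw [hasDerivAt_pi]
  intro i
  fin_cases i
  · refine hx.congr_deriv ?_
    simp only [modelField, spherePoint, Fin.zero_eta, Matrix.cons_val_zero, Matrix.cons_val_one,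
      Matrix.cons_val, Pi.pow_apply]
    generalize √(1 + ω t ^ 2) = r at *
    generalize Real.sin (Θ t) = s at *
    generalize Real.cos (Θ t) = c at *
    field_simp
    norm_num
    ring_nf
    grind
  · refine hy.congr_deriv ?_
    simp only [modelField, spherePoint, Fin.mk_one, Matrix.cons_val_zero, Matrix.cons_val_one,
      Matrix.cons_val, Pi.pow_apply]
    generalize √(1 + ω t ^ 2) = r at *
    generalize Real.sin (Θ t) = s at *
    generalize Real.cos (Θ t) = c at *
    field_simp
    norm_num
    ring_nf
  · refine hz.congr_deriv ?_
    simp only [modelField, spherePoint, Fin.reduceFinMk, Matrix.cons_val_zero, Matrix.cons_val_one,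
      Matrix.cons_val, Pi.pow_apply]
    generalize √(1 + ω t ^ 2) = r at *
    generalize Real.sin (Θ t) = s at *
    generalize Real.cos (Θ t) = c at *
    field_simp
    norm_num
    ring_nf
    grind

theorem exists_angle_modelField {ε : ℝ} {γ : ℝ → Fin 3 → ℝ}
    (hγ : ∀ t, HasDerivAt γ (modelField ε (γ t)) t) (hS : ∀ t, γ t ∈ S2)
    (hρ : ∀ t, 0 < γ t 0 ^ 2 + γ t 1 ^ 2) :
    ∃ Θ ω : ℝ → ℝ, ∀ t, ω t = γ t 2 / √(γ t 0 ^ 2 + γ t 1 ^ 2) ∧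
      Real.cos (Θ t) = γ t 0 / √(γ t 0 ^ 2 + γ t 1 ^ 2) ∧
      Real.sin (Θ t) = γ t 1 / √(γ t 0 ^ 2 + γ t 1 ^ 2) ∧
      γ t = spherePoint (ω t) (Θ t) ∧
      HasDerivAt Θ ((ω t * (1 + 8 * ε * Real.cos (Θ t) * Real.sin (Θ t)) - Real.cos (Θ t)) /
        √(1 + ω t ^ 2)) t ∧
      HasDerivAt ω (ε * √(1 + ω t ^ 2) * (8 * Real.cos (Θ t) ^ 2 - 5)) t := by
  set ρ : ℝ → ℝ := fun t => √(γ t 0 ^ 2 + γ t 1 ^ 2) with hρdef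
  have hρ0 : ∀ t, 0 < ρ t := fun t => Real.sqrt_pos.2 (hρ t)
  have hρ2 : ∀ t, ρ t ^ 2 = γ t 0 ^ 2 + γ t 1 ^ 2 := fun t => Real.sq_sqrt (hρ t).le
  have hx : ∀ t, HasDerivAt (fun t => γ t 0)
      (γ t 0 * γ t 1 - γ t 1 * γ t 2 - 3 * ε * γ t 0 * γ t 2) t := fun t =>
    hasDerivAt_pi.1 (hγ t) 0
  have hy : ∀ t, HasDerivAt (fun t => γ t 1)
      (γ t 0 * γ t 2 - γ t 0 ^ 2 + 5 * ε * γ t 1 * γ t 2) t := fun t => hasDerivAt_pi.1 (hγ t) 1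
  have hz : ∀ t, HasDerivAt (fun t => γ t 2) (ε * (3 * γ t 0 ^ 2 - 5 * γ t 1 ^ 2)) t := fun t =>
    hasDerivAt_pi.1 (hγ t) 2
  have hρd : ∀ t, HasDerivAt ρ (-γ t 2 * (ε * (3 * γ t 0 ^ 2 - 5 * γ t 1 ^ 2)) / ρ t) t := by
    intro t
    refine ((((hx t).pow 2).add ((hy t).pow 2)).sqrt (hρ t).ne').congr_deriv ?_
    change _ / (2 * ρ t) = _
    have := (hρ0 t).ne'
    field_simp
    norm_num
    ring
  have hS' : ∀ t, ρ t ^ 2 + γ t 2 ^ 2 = 1 := fun t => by rw [hρ2]; exact hS t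
  let ν : ℝ → ℝ := fun t =>
    γ t 2 - γ t 0 + 8 * ε * γ t 2 * (γ t 0 / ρ t) * (γ t 1 / ρ t)
  have hxc : Continuous fun t => γ t 0 := continuous_iff_continuousAt.2 fun t => (hx t).continuousAt
  have hyc : Continuous fun t => γ t 1 := continuous_iff_continuousAt.2 fun t => (hy t).continuousAt
  have hzc : Continuous fun t => γ t 2 := continuous_iff_continuousAt.2 fun t => (hz t).continuousAt
  have hρc : Continuous ρ := continuous_iff_continuousAt.2 fun t => (hρd t).continuousAt
  have hν : Continuous ν := by
    have h1 := hxc.div hρc fun t => (hρ0 t).ne'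
    have h2 := hyc.div hρc fun t => (hρ0 t).ne'
    simp only [ν]
    exact (hzc.sub hxc).add (((continuous_const.mul hzc).mul h1).mul h2)
  obtain ⟨Θ, hΘ, hcos, hsin⟩ := exists_angle (a := fun t => γ t 0 / ρ t)
    (b := fun t => γ t 1 / ρ t) hν
    (fun t => by
      refine ((hx t).div (hρd t) (hρ0 t).ne').congr_deriv ?_
      have := (hρ0 t).ne'
      have h2 := hρ2 t
      simp only [ν]
      field_simp
      linear_combination (-3 * ε * γ t 0 * γ t 2) * h2)
    (fun t => by
      refine ((hy t).div (hρd t) (hρ0 t).ne').congr_deriv ?_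
      have := (hρ0 t).ne'
      have h2 := hρ2 t
      simp only [ν]
      field_simp
      linear_combination (5 * ε * γ t 1 * γ t 2) * h2)
    (by
      have := (hρ0 0).ne'
      have h2 := hρ2 0
      field_simp
      linarith)
  refine ⟨Θ, fun t => γ t 2 / ρ t, fun t => ?_⟩
  have h0 := hρ0 t
  have hsq : √(1 + (γ t 2 / ρ t) ^ 2) = (ρ t)⁻¹ := by
    rw [Real.sqrt_eq_iff_mul_self_eq (by positivity) (by positivity)]
    have := hS' t
    field_simp
    linarith
  refine ⟨rfl, (hcos t).symm, (hsin t).symm, ?_, ?_, ?_⟩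
  · rw [spherePoint, hsq, ← hcos, ← hsin]
    funext i
    fin_cases i <;> simp [h0.ne']
  · refine (hΘ t).congr_deriv ?_
    rw [hsq, ← hcos, ← hsin]
    simp only [ν]
    clear_value ρ
    field_simp
    ring
  · refine ((hz t).div (hρd t) h0.ne').congr_deriv ?_
    rw [hsq, ← hcos]
    have h1 := hS' t
    have h2 := hρ2 t
    clear_value ρ
    field_simp
    grind

/-- The open set of points whose colatitude has cotangent within `δ` of `5 / 4`. -/
def cotNhd (δ : ℝ) : Set (Fin 3 → ℝ) :=
  {p | 0 < p 0 ^ 2 + p 1 ^ 2 ∧ |p 2 / √(p 0 ^ 2 + p 1 ^ 2) - 5 / 4| < δ}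

theorem isOpen_cotNhd (δ : ℝ) : IsOpen (cotNhd δ) := by
  have h0 : IsOpen {p : Fin 3 → ℝ | 0 < p 0 ^ 2 + p 1 ^ 2} :=
    isOpen_lt continuous_const (by fun_prop)
  have hc : ContinuousOn (fun p : Fin 3 → ℝ => |p 2 / √(p 0 ^ 2 + p 1 ^ 2) - 5 / 4|)
      {p | 0 < p 0 ^ 2 + p 1 ^ 2} :=
    ((ContinuousOn.div (by fun_prop) (by fun_prop)
      fun p hp => (Real.sqrt_pos.2 hp).ne').sub continuousOn_const).abs
  exact hc.isOpen_inter_preimage h0 isOpen_Iio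

theorem spherePoint_zero_sq_add_one_sq (ω θ : ℝ) :
    spherePoint ω θ 0 ^ 2 + spherePoint ω θ 1 ^ 2 = (1 / √(1 + ω ^ 2)) ^ 2 := by
  have h0 : √(1 + ω ^ 2) ≠ 0 := by positivity
  simp only [spherePoint, Matrix.cons_val_zero, Matrix.cons_val_one]
  field_simp
  linarith [Real.sin_sq_add_cos_sq θ]

theorem spherePoint_mem_cotNhd {δ ω : ℝ} (θ : ℝ) (h : |ω - 5 / 4| < δ) :
    spherePoint ω θ ∈ cotNhd δ := by
  have h0 : 0 < √(1 + ω ^ 2) := by positivity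
  refine ⟨by rw [spherePoint_zero_sq_add_one_sq]; positivity, ?_⟩
  rw [spherePoint_zero_sq_add_one_sq, Real.sqrt_sq (by positivity)]
  simp only [spherePoint, Matrix.cons_val]
  field_simp
  field_simp at h
  exact h

theorem cotSlope_mul_div_sqrt {ε θ ω : ℝ}
    (h : 1 / 8 ≤ ω * (1 + 8 * ε * Real.cos θ * Real.sin θ) - Real.cos θ) :
    cotSlope ε θ ω * ((ω * (1 + 8 * ε * Real.cos θ * Real.sin θ) - Real.cos θ) / √(1 + ω ^ 2)) =
      √(1 + ω ^ 2) * (8 * Real.cos θ ^ 2 - 5) := by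
  have h1 : √(1 + ω ^ 2) ^ 2 = 1 + ω ^ 2 := Real.sq_sqrt (by positivity)
  have h2 : √(1 + ω ^ 2) ≠ 0 := by positivity
  rw [cotSlope]
  generalize √(1 + ω ^ 2) = r at *
  generalize ω * (1 + 8 * ε * Real.cos θ * Real.sin θ) - Real.cos θ = d at *
  have h3 : d ≠ 0 := by linarith
  rw [← h1]
  field_simp

theorem isPeriodicOrbitOn_modelField {δ ε : ℝ} (hδ : δ ≤ 1) (hε : 0 < ε) (hε1 : ε ≤ 1) {W : ℝ → ℝ}
    (hW : ∀ θ, HasDerivAt W (ε * cotSlope ε θ (W θ)) θ) (hWp : Function.Periodic W (2 * Real.pi))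
    (hWδ : ∀ θ, |W θ - 5 / 4| < δ)
    (hden : ∀ θ, 1 / 8 ≤ W θ * (1 + 8 * ε * Real.cos θ * Real.sin θ) - Real.cos θ) :
    IsPeriodicOrbitOn (modelField ε) (Set.range fun θ => spherePoint (W θ) θ) := by
  let v : ℝ → ℝ := fun θ =>
    (W θ * (1 + 8 * ε * Real.cos θ * Real.sin θ) - Real.cos θ) / √(1 + W θ ^ 2)
  have hWc : Continuous W := continuous_iff_continuousAt.2 fun θ => (hW θ).continuousAt
  have hv : Continuous v := Continuous.div (by fun_prop) (by fun_prop) fun θ => by positivity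
  have hvper : ∀ θ, v (θ + 2 * Real.pi) = v θ := by
    intro θ
    simp only [v, hWp θ, Real.cos_add_two_pi, Real.sin_add_two_pi]
  have hW0 : ∀ θ, 1 / 4 < W θ ∧ W θ < 9 / 4 := by
    intro θ
    have := abs_lt.1 (hWδ θ)
    constructor <;> linarith
  have hvl : ∀ θ, 1 / 32 ≤ v θ := by
    intro θ
    have h4 : √(1 + W θ ^ 2) ≤ 4 := by
      rw [Real.sqrt_le_left (by norm_num)]
      nlinarith [hW0 θ]
    simp only [v]
    rw [le_div_iff₀ (by positivity)]
    linarith [hden θ]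
  have hvu : ∀ θ, v θ ≤ 22 := by
    intro θ
    have h1 : 1 ≤ √(1 + W θ ^ 2) := Real.one_le_sqrt.2 (by nlinarith)
    have h2 : Real.cos θ * Real.sin θ ≤ 1 := by
      nlinarith [Real.sin_sq_add_cos_sq θ, sq_nonneg (Real.cos θ - Real.sin θ)]
    have h3 : ε * (Real.cos θ * Real.sin θ) ≤ 1 := by nlinarith
    have h5 : W θ * (1 + 8 * ε * Real.cos θ * Real.sin θ) ≤ 9 / 4 * 9 := by
      nlinarith [hW0 θ]
    simp only [v]
    rw [div_le_iff₀ (by positivity)]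
    linarith [Real.neg_one_le_cos θ]
  obtain ⟨u, T, hT, hu, huT, husurj⟩ := exists_solution_add_period hv (by norm_num) hvl hvu
    Real.two_pi_pos hvper
  have hper : ∀ θ, spherePoint (W (θ + 2 * Real.pi)) (θ + 2 * Real.pi) = spherePoint (W θ) θ := by
    intro θ
    simp only [spherePoint, hWp θ, Real.cos_add_two_pi, Real.sin_add_two_pi]
  refine ⟨fun t => spherePoint (W (u t)) (u t), T, fun t => ?_, hT, fun t => ?_, fun hconst => ?_,
    ?_, ?_⟩
  · refine hasDerivAt_spherePoint (ω := fun t => W (u t)) (hu t) ?_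
    refine ((hW (u t)).comp t (hu t)).congr_deriv ?_
    rw [mul_assoc, mul_assoc, ← cotSlope_mul_div_sqrt (hden (u t))]
  · simp only [huT, hper]
  · obtain ⟨t₀, h0⟩ := husurj 0
    obtain ⟨t₁, h1⟩ := husurj Real.pi
    have h := congrFun ((hconst t₀).trans (hconst t₁).symm) 0
    simp only [h0, h1, spherePoint, Matrix.cons_val_zero, Real.cos_zero, Real.cos_pi] at h
    have a0 : 0 < 1 / √(1 + W 0 ^ 2) := by positivity
    have a1 : 0 < 1 / √(1 + W Real.pi ^ 2) := by positivity
    rw [neg_div] at h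
    linarith
  · rintro _ ⟨t, rfl⟩
    exact spherePoint_mem_S2 _ _
  · exact (husurj.range_comp fun θ => spherePoint (W θ) θ).symm

theorem eq_of_antitone_of_periodic {f : ℝ → ℝ} {T : ℝ} (hf : Antitone f) (hT : 0 < T)
    (hper : Function.Periodic f T) (a b : ℝ) : f a = f b := by
  wlog hab : a ≤ b generalizing a b
  · exact (this b a (le_of_not_ge hab)).symm
  obtain ⟨n, hn⟩ := exists_nat_ge ((b - a) / T)
  rw [div_le_iff₀ hT] at hn
  refine le_antisymm ?_ (hf hab)
  rw [← hper.nat_mul n a]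
  exact hf (by linarith)

theorem isLimitCycleOn_modelField {δ ε : ℝ} (hδ : δ ≤ 1)
    (hest : ∀ ε ω₁ ω₂ : ℝ, |ε| ≤ δ → |ω₁ - 5 / 4| ≤ δ → |ω₂ - 5 / 4| ≤ δ → ∀ θ,
      1 / 8 ≤ ω₁ * (1 + 8 * ε * Real.cos θ * Real.sin θ) - Real.cos θ ∧
      |cotSlope ε θ ω₂ - cotSlope ε θ ω₁ - cotSlopeDeriv θ * (ω₂ - ω₁)| ≤ 4 * |ω₂ - ω₁|)
    (hε : 0 < ε) (hεδ : ε ≤ δ) {W : ℝ → ℝ}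
    (hW : ∀ θ, HasDerivAt W (ε * cotSlope ε θ (W θ)) θ) (hWp : Function.Periodic W (2 * Real.pi))
    (hWδ : ∀ θ, |W θ - 5 / 4| < δ) :
    IsLimitCycleOn (modelField ε) (Set.range fun θ => spherePoint (W θ) θ) := by
  have hε' : |ε| ≤ δ := by rwa [abs_of_pos hε]
  refine ⟨isPeriodicOrbitOn_modelField hδ hε (hεδ.trans hδ) hW hWp hWδ fun θ =>
    (hest ε _ _ hε' (hWδ θ).le (hWδ θ).le θ).1, cotNhd δ, isOpen_cotNhd δ, ?_, ?_⟩
  · rintro _ ⟨θ, rfl⟩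
    exact spherePoint_mem_cotNhd θ (hWδ θ)
  rintro _ ⟨γ, T, hγ, hT, hγT, -, hS, rfl⟩ hU
  obtain ⟨Θ, ω, hΘω⟩ := exists_angle_modelField hγ (fun t => hS ⟨t, rfl⟩)
    (fun t => (hU ⟨t, rfl⟩).1)
  choose hωeq hcos hsin hpt hΘ hω using hΘω
  have hωδ : ∀ t, |ω t - 5 / 4| < δ := fun t => by
    rw [hωeq]
    exact (hU ⟨t, rfl⟩).2
  have hden : ∀ t, 1 / 8 ≤ ω t * (1 + 8 * ε * Real.cos (Θ t) * Real.sin (Θ t)) -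
      Real.cos (Θ t) := fun t => (hest ε _ _ hε' (hωδ t).le (hωδ t).le (Θ t)).1
  let ν : ℝ → ℝ := fun t =>
    (ω t * (1 + 8 * ε * Real.cos (Θ t) * Real.sin (Θ t)) - Real.cos (Θ t)) / √(1 + ω t ^ 2)
  have hν : ∀ t, 1 / 32 ≤ ν t := by
    intro t
    have h1 := abs_lt.1 (hωδ t)
    have h4 : √(1 + ω t ^ 2) ≤ 4 := by
      rw [Real.sqrt_le_left (by norm_num)]
      nlinarith
    simp only [ν]
    rw [le_div_iff₀ (by positivity)]
    linarith [hden t]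
  have hω' : ∀ t, HasDerivAt ω (ε * cotSlope ε (Θ t) (ω t) * ν t) t := by
    intro t
    refine (hω t).congr_deriv ?_
    rw [mul_assoc, mul_assoc, ← cotSlope_mul_div_sqrt (hden t)]
  obtain ⟨-, hsurj⟩ := strictMono_surjective_of_le_deriv (by norm_num : (0 : ℝ) < 1 / 32) hΘ hν
  let D : ℝ → ℝ := fun t => ω t - W (Θ t)
  let E : ℝ → ℝ := fun t => Real.exp (-(2 * ε * cotSlopeDerivPrim (Θ t)))
  let V' : ℝ → ℝ := fun t => 2 * ε * ν t * E t * (D t * (cotSlope ε (Θ t) (ω t) -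
    cotSlope ε (Θ t) (W (Θ t)) - cotSlopeDeriv (Θ t) * D t) - 82 / 9 * D t ^ 2)
  have hV : ∀ t, HasDerivAt (fun t => D t ^ 2 * E t) (V' t) t := by
    intro t
    have hD : HasDerivAt D _ t := (hω' t).sub ((hW (Θ t)).comp t (hΘ t))
    have hE : HasDerivAt E _ t :=
      (((hasDerivAt_cotSlopeDerivPrim (Θ t)).comp t (hΘ t)).const_mul (2 * ε)).neg.exp
    refine ((hD.pow 2).mul hE).congr_deriv ?_
    simp only [V']
    change _ + _ * (E t * -(2 * ε * (_ * ν t))) = _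
    change _ * (_ - _ * ν t) * E t + _ = _
    simp only [Pi.pow_apply]
    norm_num
    ring
  have hV'le : ∀ t, V' t ≤ -(ε * ν t * E t * D t ^ 2) := by
    intro t
    have h1 := (hest ε _ _ hε' (hWδ (Θ t)).le (hωδ t).le (Θ t)).2
    have h2 : D t * (cotSlope ε (Θ t) (ω t) - cotSlope ε (Θ t) (W (Θ t)) -
        cotSlopeDeriv (Θ t) * D t) ≤ 4 * D t ^ 2 := by
      refine (le_abs_self _).trans ?_
      rw [abs_mul, ← sq_abs (D t)]
      nlinarith [mul_le_mul_of_nonneg_left h1 (abs_nonneg (D t))]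
    have h3 : 0 < ε * ν t * E t :=
      mul_pos (mul_pos hε (by linarith [hν t])) (Real.exp_pos _)
    simp only [V']
    nlinarith [mul_le_mul_of_nonneg_left h2 h3.le, mul_nonneg h3.le (sq_nonneg (D t))]
  have hpos : ∀ t, 0 ≤ ε * ν t * E t * D t ^ 2 := fun t => by
    have := hν t
    have : 0 < ν t := by linarith
    positivity
  have hanti : Antitone fun t => D t ^ 2 * E t :=
    antitone_of_deriv_nonpos (fun t => (hV t).differentiableAt) fun t => by
      rw [(hV t).deriv]
      linarith [hV'le t, hpos t]
  have hVper : Function.Periodic (fun t => D t ^ 2 * E t) T := by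
    intro t
    have hc : Real.cos (Θ (t + T)) = Real.cos (Θ t) := by rw [hcos, hcos, hγT]
    have hs : Real.sin (Θ (t + T)) = Real.sin (Θ t) := by rw [hsin, hsin, hγT]
    have hωT : ω (t + T) = ω t := by rw [hωeq, hωeq, hγT]
    simp only [D, E, hωT, apply_eq_of_cos_sin_eq hWp hc hs,
      apply_eq_of_cos_sin_eq cotSlopeDerivPrim_periodic hc hs]
  have hD0 : ∀ t, ω t = W (Θ t) := by
    intro t
    have hconst : (fun t => D t ^ 2 * E t) = fun _ => D 0 ^ 2 * E 0 :=
      funext fun s => eq_of_antitone_of_periodic hanti hT hVper s 0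
    have h0 : V' t = 0 := by
      have := (hV t).deriv
      rw [hconst, deriv_const] at this
      exact this.symm
    have h1 : ε * ν t * E t * D t ^ 2 = 0 := by linarith [hV'le t, hpos t]
    have h3 : 0 < ε * ν t * E t :=
      mul_pos (mul_pos hε (by linarith [hν t])) (Real.exp_pos _)
    have h4 := pow_eq_zero_iff two_ne_zero |>.1 ((mul_eq_zero.1 h1).resolve_left h3.ne')
    simp only [D] at h4
    linarith
  have hγeq : γ = (fun θ => spherePoint (W θ) θ) ∘ Θ := by
    funext t
    rw [hpt t, hD0 t]
    rfl
  rw [hγeq, hsurj.range_comp]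

theorem mem_S2_iff_dotProduct {p : Fin 3 → ℝ} : p ∈ S2 ↔ p ⬝ᵥ p = 1 := by
  simp only [S2, Set.mem_ofPred_eq, dotProduct, Fin.sum_univ_three, sq]

theorem mulVec_mem_S2 {M : Matrix (Fin 3) (Fin 3) ℝ} (hM : M.transpose * M = 1) {p : Fin 3 → ℝ}
    (hp : p ∈ S2) : M.mulVec p ∈ S2 := by
  rw [mem_S2_iff_dotProduct] at hp ⊢
  rw [Matrix.dotProduct_mulVec, Matrix.vecMul_mulVec, ← Matrix.dotProduct_mulVec, hM,
    Matrix.one_mulVec, hp]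

theorem IsPeriodicOrbitOn.image_mulVec {X Y : (Fin 3 → ℝ) → Fin 3 → ℝ}
    {M : Matrix (Fin 3) (Fin 3) ℝ} (hM : M.transpose * M = 1)
    (h : ∀ p, X (M.mulVec p) = M.mulVec (Y p)) {Γ : Set (Fin 3 → ℝ)} (hΓ : IsPeriodicOrbitOn Y Γ) :
    IsPeriodicOrbitOn X (M.mulVec '' Γ) := by
  obtain ⟨γ, T, hγ, hT, hper, hne, hS, rfl⟩ := hΓ
  refine ⟨fun t => M.mulVec (γ t), T, fun t => ?_, hT, fun t => by simp only [hper],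
    fun hc => hne fun t => ?_, ?_, (Set.range_comp M.mulVec γ).symm⟩
  · rw [h]
    exact (Matrix.toLin' M).toContinuousLinearMap.hasFDerivAt.comp_hasDerivAt t (hγ t)
  · have := congrArg M.transpose.mulVec (hc t)
    simpa only [Matrix.mulVec_mulVec, hM, Matrix.one_mulVec] using this
  · rintro _ ⟨t, rfl⟩
    exact mulVec_mem_S2 hM (hS ⟨t, rfl⟩)

theorem IsLimitCycleOn.image_mulVec {X Y : (Fin 3 → ℝ) → Fin 3 → ℝ}
    {M : Matrix (Fin 3) (Fin 3) ℝ} (hM : M.transpose * M = 1)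
    (h : ∀ p, X (M.mulVec p) = M.mulVec (Y p)) {Γ : Set (Fin 3 → ℝ)} (hΓ : IsLimitCycleOn Y Γ) :
    IsLimitCycleOn X (M.mulVec '' Γ) := by
  obtain ⟨hΓ, U, hU, hΓU, hiso⟩ := hΓ
  have hM' : M * M.transpose = 1 := mul_eq_one_comm.1 hM
  have hleft : ∀ p, M.transpose.mulVec (M.mulVec p) = p := fun p => by
    rw [Matrix.mulVec_mulVec, hM, Matrix.one_mulVec]
  have hright : ∀ p, M.mulVec (M.transpose.mulVec p) = p := fun p => by
    rw [Matrix.mulVec_mulVec, hM', Matrix.one_mulVec]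
  refine ⟨hΓ.image_mulVec hM h, M.transpose.mulVec ⁻¹' U,
    hU.preimage (Continuous.matrix_mulVec continuous_const continuous_id), ?_,
    fun Γ' hΓ' hΓ'U => ?_⟩
  · rintro _ ⟨p, hp, rfl⟩
    rw [Set.mem_preimage, hleft]
    exact hΓU hp
  · have h' : ∀ p, Y (M.transpose.mulVec p) = M.transpose.mulVec (X p) := fun p => by
      rw [← hright p, h, hleft, hleft]
    rw [← hiso _ (hΓ'.image_mulVec (by rwa [Matrix.transpose_transpose]) h')
      (Set.image_subset_iff.2 hΓ'U), Set.image_image]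
    simp only [hright, Set.image_id']

theorem exists_Xfam_conj_modelField {ε : ℝ} (hε : 0 < ε) (hε1 : ε ≤ 1 / 10) :
    ∃ a1 a2 a5 a7 a8 : ℝ, a1 ≠ 0 ∧ a2 * (a5 + a7) - a1 * a8 ≠ 0 ∧ 0 < a5 * a7 ∧
      ∃ M : Matrix (Fin 3) (Fin 3) ℝ, M.transpose * M = 1 ∧
        ∀ v, Xfam a1 a2 a5 a7 a8 (M.mulVec v) = M.mulVec (modelField ε v) := by
  obtain ⟨p, hp0, hp⟩ : ∃ p : ℝ, 0 < p ∧ p ^ 2 = 3 / 8 :=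
    ⟨√(3 / 8), by positivity, Real.sq_sqrt (by norm_num)⟩
  obtain ⟨q, hq0, hq⟩ : ∃ q : ℝ, 0 < q ∧ q ^ 2 = 5 / 8 :=
    ⟨√(5 / 8), by positivity, Real.sq_sqrt (by norm_num)⟩
  have hpq : 0 < p * q := mul_pos hp0 hq0
  have hpq1 : p * q ≤ 1 / 2 := by nlinarith [sq_nonneg (p - q)]
  obtain ⟨l, hl⟩ : ∃ l, l = 1 - 8 * ε * (p * q) := ⟨_, rfl⟩
  have hl0 : 0 < l := by nlinarith
  obtain ⟨i, hi0, hi⟩ : ∃ i : ℝ, 0 < i ∧ i ^ 2 * (l ^ 2 + q ^ 2) = 1 := by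
    refine ⟨(√(l ^ 2 + q ^ 2))⁻¹, by positivity, ?_⟩
    rw [inv_pow, Real.sq_sqrt (by positivity), inv_mul_cancel₀ (by positivity)]
  refine ⟨q, i * (2 * l * ε + q * p), -16 * ε * (p * q), -l, i * (2 * q * ε - l * p), hq0.ne', ?_,
    ?_, !![i * q * q, -(i * q * p), -(i * l); p, q, 0; i * l * q, -(i * l * p), i * q], ?_, ?_⟩
  · have h1 : i * (2 * l * ε + q * p) * (-16 * ε * (p * q) + -l) - q * (i * (2 * q * ε - l * p)) =
        -(i * (2 * ε * (l ^ 2 + q ^ 2) + 16 * ε * (p * q) * (2 * l * ε + q * p))) := by ring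
    rw [h1]
    have : 0 < i * (2 * ε * (l ^ 2 + q ^ 2) + 16 * ε * (p * q) * (2 * l * ε + q * p)) := by
      positivity
    linarith
  · nlinarith [mul_pos (mul_pos hε hpq) hl0]
  · rw [mul_eq_one_comm]
    ext j k
    fin_cases j <;> fin_cases k <;>
      simp [Matrix.mul_apply, Fin.sum_univ_three] <;> grind
  · intro v
    have h0 : q * (q * (q * v 0 - p * v 1) - l * v 2) * (p * v 0 + q * v 1) +
        (2 * l * ε + q * p) * (p * v 0 + q * v 1) ^ 2 -
        16 * ε * (p * q) * (p * v 0 + q * v 1) * (l * (q * v 0 - p * v 1) + q * v 2) =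
        q * (q * (v 0 * v 1 - v 1 * v 2 - 3 * ε * v 0 * v 2) -
          p * (v 0 * v 2 - v 0 ^ 2 + 5 * ε * v 1 * v 2)) -
        l * (ε * (3 * v 0 ^ 2 - 5 * v 1 ^ 2)) := by
      subst hl
      grind
    have h1 : -q * (q * (q * v 0 - p * v 1) - l * v 2) ^ 2 -
        (2 * l * ε + q * p) * (q * (q * v 0 - p * v 1) - l * v 2) * (p * v 0 + q * v 1) -
        l * (q * (q * v 0 - p * v 1) - l * v 2) * (l * (q * v 0 - p * v 1) + q * v 2) +
        (2 * q * ε - l * p) * (p * v 0 + q * v 1) * (l * (q * v 0 - p * v 1) + q * v 2) =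
        (l ^ 2 + q ^ 2) * (p * (v 0 * v 1 - v 1 * v 2 - 3 * ε * v 0 * v 2) +
          q * (v 0 * v 2 - v 0 ^ 2 + 5 * ε * v 1 * v 2)) := by
      subst hl
      grind
    have h2 : (16 * ε * (p * q) + l) * (q * (q * v 0 - p * v 1) - l * v 2) * (p * v 0 + q * v 1) -
        (2 * q * ε - l * p) * (p * v 0 + q * v 1) ^ 2 =
        l * (q * (v 0 * v 1 - v 1 * v 2 - 3 * ε * v 0 * v 2) -
          p * (v 0 * v 2 - v 0 ^ 2 + 5 * ε * v 1 * v 2)) +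
        q * (ε * (3 * v 0 ^ 2 - 5 * v 1 ^ 2)) := by
      subst hl
      grind
    funext j
    fin_cases j <;>
      simp only [Xfam, modelField, Matrix.mulVec, dotProduct, Fin.sum_univ_three, Fin.zero_eta,
        Fin.mk_one, Fin.reduceFinMk, Matrix.cons_val_zero, Matrix.cons_val_one, Matrix.cons_val,
        Matrix.of_apply]
    · linear_combination i * h0
    · linear_combination i ^ 2 * h1 + (p * (v 0 * v 1 - v 1 * v 2 - 3 * ε * v 0 * v 2) +
          q * (v 0 * v 2 - v 0 ^ 2 + 5 * ε * v 1 * v 2)) * hi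
    · linear_combination i * h2

/-- There exist parameters `a₁ ≠ 0`, `a₂(a₅+a₇) - a₁a₈ ≠ 0`, `a₅a₇ > 0`
such that the corresponding vector field of the family (eq. 142) has at least one limit cycle
on `S²`; in particular there are degree-2 homogeneous polynomial vector fields on `S²` with a
limit cycle. -/
theorem stmt19 :
    ∃ a1 a2 a5 a7 a8 : ℝ, a1 ≠ 0 ∧ a2 * (a5 + a7) - a1 * a8 ≠ 0 ∧ 0 < a5 * a7 ∧
      ∃ Γ, IsLimitCycleOn (Xfam a1 a2 a5 a7 a8) Γ := by
  obtain ⟨δ, hδ0, hδ, hest⟩ := exists_cotSlope_estimate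
  obtain ⟨ε, hε, hεδ⟩ : ∃ ε : ℝ, 0 < ε ∧ 10 ^ 6 * ε ≤ δ := ⟨δ / 10 ^ 6, by positivity, by linarith⟩
  obtain ⟨W, hW, hWp, hWδ⟩ := exists_periodic_cotSlope_solution hδ hest hε hεδ
  obtain ⟨a1, a2, a5, a7, a8, h1, h2, h3, M, hM, hconj⟩ :=
    exists_Xfam_conj_modelField hε (by linarith)
  exact ⟨a1, a2, a5, a7, a8, h1, h2, h3, _,
    (isLimitCycleOn_modelField hδ hest hε (by linarith) hW hWp hWδ).image_mulVec hM hconj⟩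
end
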